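/- For n ≥ 4, the descent algebra ΣB_{n-2} of the hyperoctahedral group B_{n-2} is isomorphic as a ℚ-algebra to the quotient ΣD_n/𝓘. -/

import Mathlib

open scoped Classical

namespace DescentD

/-- The domain on which the Coxeter group `D_n` acts: the pair `(k, b)` encodes the
integer `k + 1` if `b = true` and `-(k + 1)` if `b = false`.  (We use `Fin (n + 1)`
so that the type is always nonempty; only the points with `k < n` are moved.) -/
abbrev Dom (n : ℕ) := Fin (n + 1) × Bool

/-- The point of `Dom n` encoding the nonzero integer `a` (for `1 ≤ |a| ≤ n`). -/
def pt (n : ℕ) (a : ℤ) : Dom n :=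
  (⟨(a.natAbs - 1) % (n + 1), Nat.mod_lt _ n.succ_pos⟩, decide (0 < a))

/-- The transposition exchanging the points encoding `a` and `b`. -/
def swapD (n : ℕ) (a b : ℤ) : Equiv.Perm (Dom n) := Equiv.swap (pt n a) (pt n b)

/-- The Coxeter generators of `D_n`:  index `0` is `s_{1'} = (-2,1)(-1,2)` and index
`i` with `1 ≤ i ≤ n - 1` is `s_i = (-i-1,-i)(i,i+1)`. -/
def gen (n : ℕ) (i : ℕ) : Equiv.Perm (Dom n) :=
  if i = 0 then swapD n (-2) 1 * swapD n (-1) 2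
  else swapD n (-(i : ℤ) - 1) (-(i : ℤ)) * swapD n (i : ℤ) ((i : ℤ) + 1)

/-- The Coxeter group `D_n`, as the subgroup generated by `s_{1'}, s_1, …, s_{n-1}`. -/
def Dgroup (n : ℕ) : Subgroup (Equiv.Perm (Dom n)) :=
  Subgroup.closure (gen n '' Set.Iio n)

/-- Coxeter length of `w` with respect to the generators of `D_n`. -/
noncomputable def len (n : ℕ) (w : Equiv.Perm (Dom n)) : ℕ :=
  sInf {k | ∃ l : List ℕ, (∀ i ∈ l, i < n) ∧ l.length = k ∧ (l.map (gen n)).prod = w}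

/-- The parabolic subgroup `W_J` for a set `J` of generator indices. -/
def WJ (n : ℕ) (J : Set ℕ) : Subgroup (Equiv.Perm (Dom n)) :=
  Subgroup.closure (gen n '' J)

/-- The set `X_J` of minimal length left coset representatives of `W_J` in `D_n`. -/
def X (n : ℕ) (J : Set ℕ) : Set (Equiv.Perm (Dom n)) :=
  {w | w ∈ Dgroup n ∧ ∀ u ∈ WJ n J, len n w ≤ len n (w * u)}

/-- `𝒳_J`: the sum, in the group algebra `ℚ[D_n]`, of the minimal length left coset
representatives of `W_J`. -/
noncomputable def XX (n : ℕ) (J : Set ℕ) : MonoidAlgebra ℚ (Equiv.Perm (Dom n)) :=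
  ∑ w : Equiv.Perm (Dom n),
    if w ∈ X n J then MonoidAlgebra.of ℚ (Equiv.Perm (Dom n)) w else 0

/-- `q` is a composition of `m`: a list of positive integers with sum `m`. -/
def IsComposition (q : List ℕ) (m : ℕ) : Prop := (∀ x ∈ q, 0 < x) ∧ q.sum = m

/-- The four families making up `C(n)`:  `C_{<n}`, `C_1`, `C_n` and `C_n'`. -/
inductive Kind | lt | one | reg | prime
deriving DecidableEq

/-- Membership of a composition in each of the four families of `C(n)`. -/
def memC (n : ℕ) : Kind → List ℕ → Prop
  | .lt, q => (∀ x ∈ q, 0 < x) ∧ q.sum + 2 ≤ n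
  | .one, q => (∀ x ∈ q, 0 < x) ∧ q.sum = n ∧ q.headD 0 = 1
  | .reg, q => (∀ x ∈ q, 0 < x) ∧ q.sum = n ∧ 2 ≤ q.headD 0
  | .prime, q => (∀ x ∈ q, 0 < x) ∧ q.sum = n ∧ 2 ≤ q.headD 0

/-- The sum of the first `j` components of `q`. -/
def psum (q : List ℕ) (j : ℕ) : ℕ := (q.take j).sum

/-- The subset of generator indices (`0` standing for `s_{1'}`, `i ≥ 1` for `s_i`)
corresponding to `q ∈ C(n)`. -/
def JofC (n : ℕ) : Kind → List ℕ → Set ℕ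
  | .lt, q => {s | ∃ j < q.length, s = (n - q.sum) + psum q j}
  | .one, q => {0} ∪ {s | ∃ j, 1 ≤ j ∧ j < q.length ∧ s = psum q j}
  | .reg, q => {0} ∪ {s | ∃ j, 1 ≤ j ∧ j < q.length ∧ s = psum q j}
  | .prime, q => {1} ∪ {s | ∃ j, 1 ≤ j ∧ j < q.length ∧ s = psum q j}

/-- The basis element `B_q = 𝒳_{J^c}` of `ΣD_n`, for `q` in the family `k` of `C(n)`. -/
noncomputable def B (n : ℕ) (k : Kind) (q : List ℕ) :
    MonoidAlgebra ℚ (Equiv.Perm (Dom n)) :=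
  XX n (Set.Iio n \ JofC n k q)

/-! ### The hyperoctahedral group `B_m` and its descent algebra -/

/-- The Coxeter generators of the hyperoctahedral group `B_m`: index `0` is
`t_0 = (-1,1)` and index `i` with `1 ≤ i ≤ m-1` is `t_i = (-i-1,-i)(i,i+1)`. -/
def genB (m : ℕ) (i : ℕ) : Equiv.Perm (Dom m) :=
  if i = 0 then swapD m (-1) 1
  else swapD m (-(i : ℤ) - 1) (-(i : ℤ)) * swapD m (i : ℤ) ((i : ℤ) + 1)

/-- The hyperoctahedral group `B_m`, generated by `t_0, t_1, …, t_{m-1}`. -/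
def Bgroup (m : ℕ) : Subgroup (Equiv.Perm (Dom m)) :=
  Subgroup.closure (genB m '' Set.Iio m)

/-- Coxeter length in `B_m`. -/
noncomputable def lenB (m : ℕ) (w : Equiv.Perm (Dom m)) : ℕ :=
  sInf {k | ∃ l : List ℕ, (∀ i ∈ l, i < m) ∧ l.length = k ∧ (l.map (genB m)).prod = w}

/-- The parabolic subgroup `W_K` of `B_m`. -/
def WKB (m : ℕ) (K : Set ℕ) : Subgroup (Equiv.Perm (Dom m)) :=
  Subgroup.closure (genB m '' K)

/-- Minimal length left coset representatives of `W_K` in `B_m`. -/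
def XB (m : ℕ) (K : Set ℕ) : Set (Equiv.Perm (Dom m)) :=
  {w | w ∈ Bgroup m ∧ ∀ u ∈ WKB m K, lenB m w ≤ lenB m (w * u)}

/-- `𝒳_K ∈ ℚ[B_m]`: the sum of the minimal length left coset representatives of `W_K`. -/
noncomputable def XXB (m : ℕ) (K : Set ℕ) : MonoidAlgebra ℚ (Equiv.Perm (Dom m)) :=
  ∑ w : Equiv.Perm (Dom m),
    if w ∈ XB m K then MonoidAlgebra.of ℚ (Equiv.Perm (Dom m)) w else 0

/-- The descent algebra `ΣB_m`, as a subalgebra of `ℚ[B_m]` (it is generated, indeed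
spanned, by the elements `𝒳_K`). -/
noncomputable def SigmaBalg (m : ℕ) : Subalgebra ℚ (MonoidAlgebra ℚ (Equiv.Perm (Dom m))) :=
  Algebra.adjoin ℚ {a | ∃ K ⊆ Set.Iio m, a = XXB m K}

/-- The descent algebra `ΣD_n`, as a subalgebra of `ℚ[D_n]` (it is generated, indeed
spanned, by the elements `𝒳_J`). -/
noncomputable def SigmaDalg (n : ℕ) : Subalgebra ℚ (MonoidAlgebra ℚ (Equiv.Perm (Dom n))) :=
  Algebra.adjoin ℚ {a | ∃ J ⊆ Set.Iio n, a = XX n J}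

/-- The elements `B_q` with `q ∈ C_1 ∪ C_n ∪ C_n'`, as elements of `ΣD_n`. -/
def idealGensSub (n : ℕ) : Set ↥(SigmaDalg n) :=
  {x | ∃ k q, k ≠ Kind.lt ∧ memC n k q ∧
    (x : MonoidAlgebra ℚ (Equiv.Perm (Dom n))) = B n k q}

/-- The two-sided ideal `𝓘` of `ΣD_n` spanned by `{B_q : q ∈ C_1 ∪ C_n ∪ C_n'}`. -/
noncomputable def IdealI (n : ℕ) : TwoSidedIdeal ↥(SigmaDalg n) :=
  TwoSidedIdeal.span (idealGensSub n)

/-! ### Coxeter combinatorics of a group given by generators -/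

section Words

variable {Γ : Type*} [Group Γ]

/-- The subgroup generated by the `s i` with `i` in `J`. -/
def genSubgroup (s : ℕ → Γ) (J : Set ℕ) : Subgroup Γ := Subgroup.closure (s '' J)

/-- Word length with respect to the generators `s 0, …, s (r - 1)`. -/
noncomputable def wordLen (s : ℕ → Γ) (r : ℕ) (w : Γ) : ℕ :=
  sInf {k | ∃ l : List ℕ, (∀ i ∈ l, i < r) ∧ l.length = k ∧ (l.map s).prod = w}

/-- Elements of minimal length in their left coset of the parabolic subgroup `J`. -/
def minReps (s : ℕ → Γ) (r : ℕ) (J : Set ℕ) : Set Γ :=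
  {w | w ∈ genSubgroup s (Set.Iio r) ∧
    ∀ u ∈ genSubgroup s J, wordLen s r w ≤ wordLen s r (w * u)}

variable {s : ℕ → Γ} {r : ℕ}

lemma gen_mem_genSubgroup {J : Set ℕ} {i : ℕ} (hi : i ∈ J) : s i ∈ genSubgroup s J :=
  Subgroup.subset_closure ⟨i, hi, rfl⟩

lemma genSubgroup_mono {J K : Set ℕ} (h : J ⊆ K) : genSubgroup s J ≤ genSubgroup s K :=
  Subgroup.closure_mono (Set.image_mono h)

lemma prod_word_mem {l : List ℕ} (hl : ∀ i ∈ l, i < r) :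
    (l.map s).prod ∈ genSubgroup s (Set.Iio r) := by
  refine Subgroup.list_prod_mem _ fun x hx => ?_
  obtain ⟨i, hi, rfl⟩ := List.mem_map.1 hx
  exact gen_mem_genSubgroup (hl i hi)

lemma exists_word (hsq : ∀ i < r, s i * s i = 1) {w : Γ}
    (hw : w ∈ genSubgroup s (Set.Iio r)) :
    ∃ l : List ℕ, (∀ i ∈ l, i < r) ∧ (l.map s).prod = w := by
  induction hw using Subgroup.closure_induction with
  | mem x hx =>
    obtain ⟨i, hi, rfl⟩ := hx
    exact ⟨[i], by simpa using hi, by simp⟩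
  | one => exact ⟨[], by simp, by simp⟩
  | mul x y _ _ hx hy =>
    obtain ⟨l, hl, rfl⟩ := hx
    obtain ⟨l', hl', rfl⟩ := hy
    refine ⟨l ++ l', ?_, by simp⟩
    intro i hi
    rcases List.mem_append.1 hi with h | h
    exacts [hl i h, hl' i h]
  | inv x _ hx =>
    obtain ⟨l, hl, rfl⟩ := hx
    refine ⟨l.reverse, by simpa using hl, ?_⟩
    induction l with
    | nil => simp
    | cons i t ih =>
      have hi : (s i)⁻¹ = s i := inv_eq_of_mul_eq_one_left (hsq i (hl i (by simp)))
      rw [List.map_cons, List.prod_cons, mul_inv_rev, hi, List.reverse_cons, List.map_append,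
        List.prod_append, ih (fun j hj => hl j (by simp [hj]))
          (prod_word_mem fun j hj => hl j (by simp [hj]))]
      simp

lemma wordLen_le {l : List ℕ} (hl : ∀ i ∈ l, i < r) :
    wordLen s r (l.map s).prod ≤ l.length :=
  Nat.sInf_le ⟨l, hl, rfl, rfl⟩

lemma exists_reduced_word (hsq : ∀ i < r, s i * s i = 1) {w : Γ}
    (hw : w ∈ genSubgroup s (Set.Iio r)) :
    ∃ l : List ℕ, (∀ i ∈ l, i < r) ∧ l.length = wordLen s r w ∧ (l.map s).prod = w := by
  obtain ⟨l, hl, hlw⟩ := exists_word hsq hw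
  exact Nat.sInf_mem (s := {k | ∃ l : List ℕ, (∀ i ∈ l, i < r) ∧ l.length = k ∧
    (l.map s).prod = w}) ⟨l.length, l, hl, rfl, hlw⟩

lemma exists_mul_mem_minReps {J : Set ℕ} (hJ : J ⊆ Set.Iio r) {w : Γ}
    (hw : w ∈ genSubgroup s (Set.Iio r)) :
    ∃ u ∈ genSubgroup s J, w * u ∈ minReps s r J := by
  let S : Set ℕ := {k | ∃ u ∈ genSubgroup s J, wordLen s r (w * u) = k}
  have hS : S.Nonempty := ⟨_, 1, one_mem _, rfl⟩
  obtain ⟨u, hu, hk⟩ := Nat.sInf_mem hS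
  refine ⟨u, hu, mul_mem hw (genSubgroup_mono hJ hu), fun v hv => ?_⟩
  rw [hk, mul_assoc]
  exact Nat.sInf_le ⟨u * v, mul_mem hu hv, rfl⟩

end Words

/-! ### Sign vectors and the Tits product -/

/-- Sign vectors indexed by `ι`, with the Tits product as multiplication. -/
def SignVec (ι : Type*) := ι → SignType

namespace SignVec

variable {Γ ι : Type*} [Group Γ] [MulAction Γ ι]

noncomputable instance [Finite ι] : Fintype (SignVec ι) :=
  haveI : Finite (SignVec ι) := inferInstanceAs (Finite (ι → SignType))
  Fintype.ofFinite _

@[ext] lemma ext {F G : SignVec ι} (h : ∀ a, F a = G a) : F = G := funext h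

instance : Monoid (SignVec ι) where
  mul F G := fun a => if F a = 0 then G a else F a
  one := fun _ => 0
  mul_assoc F G H := by
    funext a
    change (if (if F a = 0 then G a else F a) = 0 then H a else (if F a = 0 then G a else F a)) =
      if F a = 0 then (if G a = 0 then H a else G a) else F a
    split_ifs <;> simp_all
  one_mul F := by
    funext a
    exact if_pos rfl
  mul_one F := by
    funext a
    change (if F a = 0 then 0 else F a) = F a
    split_ifs with h
    exacts [h.symm, rfl]

lemma mul_apply (F G : SignVec ι) (a : ι) : (F * G) a = if F a = 0 then G a else F a := rfl

lemma one_apply (a : ι) : (1 : SignVec ι) a = 0 := rfl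

/-- The action of a group element on sign vectors. -/
def act (g : Γ) : SignVec ι →* SignVec ι where
  toFun F := fun a => F (g⁻¹ • a)
  map_one' := rfl
  map_mul' _ _ := rfl

lemma act_apply (g : Γ) (F : SignVec ι) (a : ι) : act g F a = F (g⁻¹ • a) := rfl

lemma act_mul (g h : Γ) (F : SignVec ι) :
    act (g * h) F = act g (act h F) := by
  ext a
  simp [act_apply, mul_smul]

lemma act_one (F : SignVec ι) : act (1 : Γ) F = F := by
  ext a
  simp [act_apply]

lemma act_inv_eq {g : Γ} {F G : SignVec ι} :
    act g⁻¹ F = G ↔ F = act g G := by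
  constructor
  · rintro rfl
    rw [← act_mul, mul_inv_cancel, act_one]
  · rintro rfl
    rw [← act_mul, inv_mul_cancel, act_one]

lemma act_injective (g : Γ) : Function.Injective (act (ι := ι) g) := by
  intro F G h
  rw [← act_inv_eq.2 h, ← act_mul, inv_mul_cancel, act_one]

end SignVec

open SignVec

/-! ### Coxeter arrangements -/

/-- The combinatorics of a finite Coxeter arrangement: generators `s i`, simple roots, the monoid
of faces and the standard faces `face J` (on which exactly the simple roots in `J` vanish, all
others being positive). -/
structure Arrangement {Γ ι : Type*} [Group Γ] [MulAction Γ ι] (s : ℕ → Γ) (r : ℕ)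
    (root : ℕ → ι) (faces : Submonoid (SignVec ι)) (face : Finset ℕ → SignVec ι) : Prop where
  sq : ∀ i < r, s i * s i = 1
  act_gen_mem : ∀ i < r, ∀ F ∈ faces, act (s i) F ∈ faces
  face_mem : ∀ J, face J ∈ faces
  face_root : ∀ J, ∀ i < r, face J (root i) = if i ∈ J then 0 else 1
  eq_face : ∀ F ∈ faces, (∀ i < r, F (root i) ≠ -1) →
    F = face ((Finset.range r).filter fun i => F (root i) = 0)
  neg_root : ∀ i < r, ∀ F ∈ faces, F (s i • root i) = -F (root i)
  simple : ∀ i < r, ∀ β, face ∅ β = 1 → face ∅ (s i • β) = -1 →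
    ∀ F ∈ faces, F β = F (root i)
  conj : ∀ u ∈ genSubgroup s (Set.Iio r), ∀ i < r, ∀ j < r, face ∅ (u • root j) = 1 →
    face ∅ (s i • u • root j) = -1 → s i * u = u * s j
  fix : ∀ i < r, ∀ F ∈ faces, F (root i) = 0 → act (s i) F = F
  ne_zero_gen : ∀ i < r, ∀ β, face ∅ β ≠ 0 → face ∅ (s i • β) ≠ 0
  exists_neg : ∃ F ∈ faces, ∀ i < r, F (root i) = -1

namespace Arrangement

variable {Γ ι : Type*} [Group Γ] [MulAction Γ ι] {s : ℕ → Γ} {r : ℕ}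
  {root : ℕ → ι} {faces : Submonoid (SignVec ι)} {face : Finset ℕ → SignVec ι}

lemma eq_one_or_neg_one {a : SignType} (h : a ≠ 0) : a = 1 ∨ a = -1 := by
  revert h; revert a; decide

lemma ne_zero (A : Arrangement s r root faces face) {w : Γ}
    (hw : w ∈ genSubgroup s (Set.Iio r)) {i : ℕ} (hi : i < r) : face ∅ (w • root i) ≠ 0 := by
  obtain ⟨l, hl, rfl⟩ := exists_word A.sq hw
  clear hw
  induction l with
  | nil => simp [A.face_root ∅ i hi]
  | cons j t ih =>
    rw [List.map_cons, List.prod_cons, mul_smul]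
    exact A.ne_zero_gen j (hl j (by simp)) _ (ih fun k hk => hl k (by simp [hk]))

lemma act_mem (A : Arrangement s r root faces face) {g : Γ}
    (hg : g ∈ genSubgroup s (Set.Iio r)) {F : SignVec ι} (hF : F ∈ faces) :
    act g F ∈ faces := by
  obtain ⟨l, hl, rfl⟩ := exists_word A.sq hg
  induction l with
  | nil => simpa [act_one] using hF
  | cons i t ih =>
    rw [List.map_cons, List.prod_cons, act_mul]
    have ht : ∀ j ∈ t, j < r := fun j hj => hl j (by simp [hj])
    exact A.act_gen_mem i (hl i (by simp)) _ (ih ht (prod_word_mem ht))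

lemma face_smul_gen_smul_root (A : Arrangement s r root faces face) {w : Γ}
    (hw : w ∈ genSubgroup s (Set.Iio r)) {j : ℕ} (hj : j < r) :
    face ∅ (w • s j • root j) = -face ∅ (w • root j) := by
  have h := A.neg_root j hj _ (A.act_mem (inv_mem hw) (A.face_mem ∅))
  simpa [act_apply] using h

/-- The exchange condition. -/
lemma exchange (A : Arrangement s r root faces face) {j : ℕ} (hj : j < r) (l : List ℕ)
    (hl : ∀ i ∈ l, i < r) (h : face ∅ ((l.map s).prod • root j) = -1) :
    ∃ l' : List ℕ, (∀ i ∈ l', i < r) ∧ l'.length + 1 = l.length ∧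
      (l'.map s).prod = (l.map s).prod * s j := by
  induction l with
  | nil =>
    have := A.face_root ∅ j hj
    simp_all
  | cons i t ih =>
    have ht : ∀ i ∈ t, i < r := fun k hk => hl k (by simp [hk])
    have hi : i < r := hl i (by simp)
    rcases eq_one_or_neg_one (A.ne_zero (prod_word_mem ht) hj) with h1 | h1
    · refine ⟨t, ht, by simp, ?_⟩
      have := A.conj _ (prod_word_mem ht) i hi j hj h1 (by simpa [mul_smul] using h)
      rw [List.map_cons, List.prod_cons, this, mul_assoc, A.sq j hj, mul_one]
    · obtain ⟨l', hl', hlen, hp⟩ := ih ht h1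
      refine ⟨i :: l', ?_, by simp [hlen], by simp [hp, mul_assoc]⟩
      intro k hk
      rcases List.mem_cons.1 hk with rfl | hk
      exacts [hi, hl' k hk]

lemma wordLen_mul_gen_lt (A : Arrangement s r root faces face) {w : Γ}
    (hw : w ∈ genSubgroup s (Set.Iio r)) {j : ℕ} (hj : j < r)
    (h : face ∅ (w • root j) = -1) : wordLen s r (w * s j) < wordLen s r w := by
  obtain ⟨l, hl, hlen, rfl⟩ := exists_reduced_word A.sq hw
  obtain ⟨l', hl', hlen', hp⟩ := A.exchange hj l hl h
  rw [← hp, ← hlen, ← hlen']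
  exact Nat.lt_succ_of_le (wordLen_le hl')

lemma eq_one_of_forall_pos (A : Arrangement s r root faces face) {w : Γ}
    (hw : w ∈ genSubgroup s (Set.Iio r)) (h : ∀ j < r, face ∅ (w • root j) = 1) : w = 1 := by
  obtain ⟨l, hl, hlen, rfl⟩ := exists_reduced_word A.sq hw
  rcases List.eq_nil_or_concat l with rfl | ⟨t, j, rfl⟩
  · simp
  · exfalso
    rw [List.concat_eq_append] at *
    have ht : ∀ i ∈ t, i < r := fun i hi => hl i (by simp [hi])
    have hj : j < r := hl j (by simp)
    have h1 := h j hj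
    have h2 := A.face_smul_gen_smul_root (prod_word_mem ht) hj
    simp only [List.map_append, List.prod_append, List.map_cons, List.map_nil, List.prod_cons,
      List.prod_nil, mul_one, mul_smul] at h1
    rw [h1] at h2
    obtain ⟨l', hl', hlen', hp⟩ := A.exchange hj t ht (by rw [h2, neg_neg])
    have h3 : (l'.map s).prod = ((t ++ [j]).map s).prod := by simp [hp]
    have h4 := wordLen_le (s := s) hl'
    rw [h3, ← hlen] at h4
    simp at h4
    omega

lemma eq_one_of_act_eq (A : Arrangement s r root faces face) {w : Γ}
    (hw : w ∈ genSubgroup s (Set.Iio r)) (h : act w (face ∅) = face ∅) : w = 1 := by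
  refine A.eq_one_of_forall_pos hw fun j hj => ?_
  rw [← h, act_apply, inv_smul_smul, A.face_root ∅ j hj]
  simp

lemma eq_of_act_eq (A : Arrangement s r root faces face) {v w : Γ}
    (hv : v ∈ genSubgroup s (Set.Iio r)) (hw : w ∈ genSubgroup s (Set.Iio r))
    (h : act v (face ∅) = act w (face ∅)) : v = w := by
  have := A.eq_one_of_act_eq (mul_mem (inv_mem hw) hv)
    (by rw [act_mul, act_inv_eq, h])
  rwa [inv_mul_eq_one, eq_comm] at this

lemma act_face (A : Arrangement s r root faces face) {J : Finset ℕ}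
    (hJ : J ⊆ Finset.range r) {u : Γ} (hu : u ∈ genSubgroup s (J : Set ℕ)) :
    act u (face J) = face J := by
  induction hu using Subgroup.closure_induction with
  | mem x hx =>
    obtain ⟨i, hi, rfl⟩ := hx
    have hir : i < r := Finset.mem_range.1 (hJ hi)
    refine A.fix i hir _ (A.face_mem J) ?_
    rw [A.face_root J i hir, if_pos (by simpa using hi)]
  | one => exact act_one _
  | mul x y _ _ hx hy => rw [act_mul, hy, hx]
  | inv x _ hx => rw [act_inv_eq, hx]

lemma eq_face_empty (A : Arrangement s r root faces face) {F : SignVec ι} (hF : F ∈ faces)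
    (h : ∀ i < r, F (root i) = 1) : F = face ∅ := by
  have := A.eq_face F hF (fun i hi => by rw [h i hi]; decide)
  rw [this, Finset.filter_eq_empty_iff.2]
  intro i hi
  rw [h i (Finset.mem_range.1 hi)]
  decide

lemma act_face_mul (A : Arrangement s r root faces face) {J : Finset ℕ} {w : Γ}
    (hw : w ∈ genSubgroup s (Set.Iio r)) (hJ : ∀ j ∈ J, face ∅ (w • root j) = 1) :
    act w (face J) * face ∅ = act w (face ∅) := by
  have key : face J * act w⁻¹ (face ∅) = face ∅ := by
    refine A.eq_face_empty
      (mul_mem (A.face_mem J) (A.act_mem (inv_mem hw) (A.face_mem ∅))) fun i hi => ?_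
    rw [mul_apply, A.face_root J i hi]
    by_cases h : i ∈ J
    · simp [h, act_apply, hJ i h]
    · simp [h]
  rw [← key, map_mul, ← act_mul, mul_inv_cancel, act_one, key]

lemma mem_minReps_iff (A : Arrangement s r root faces face) {J : Finset ℕ}
    (hJ : J ⊆ Finset.range r) {w : Γ} :
    w ∈ minReps s r (J : Set ℕ) ↔
      w ∈ genSubgroup s (Set.Iio r) ∧ ∀ j ∈ J, face ∅ (w • root j) = 1 := by
  have hJ' : (J : Set ℕ) ⊆ Set.Iio r := fun j hj => by simpa using hJ hj
  have key : ∀ w ∈ minReps s r (J : Set ℕ),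
      w ∈ genSubgroup s (Set.Iio r) ∧ ∀ j ∈ J, face ∅ (w • root j) = 1 := by
    intro w hw
    refine ⟨hw.1, fun j hj => ?_⟩
    have hjr : j < r := Finset.mem_range.1 (hJ hj)
    rcases eq_one_or_neg_one (A.ne_zero hw.1 hjr) with h | h
    · exact h
    · have h1 := A.wordLen_mul_gen_lt hw.1 hjr h
      have h2 := hw.2 (s j) (gen_mem_genSubgroup (by simpa using hj))
      omega
  refine ⟨key w, fun ⟨hw, hpos⟩ => ?_⟩
  obtain ⟨u, hu, hwu⟩ := exists_mul_mem_minReps hJ' hw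
  obtain ⟨h1, h2⟩ := key _ hwu
  have h3 := A.act_face_mul h1 h2
  rw [act_mul, A.act_face hJ hu, A.act_face_mul hw hpos] at h3
  rwa [A.eq_of_act_eq hw h1 h3]

lemma exists_eq_act_face [Finite ι] (A : Arrangement s r root faces face) {F : SignVec ι}
    (hF : F ∈ faces) :
    ∃ w ∈ genSubgroup s (Set.Iio r), ∃ J ⊆ Finset.range r, F = act w (face J) := by
  have := Fintype.ofFinite ι
  induction hk : (Finset.univ.filter fun β => face ∅ β = 1 ∧ F β = -1).card using
    Nat.strong_induction_on generalizing F with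
  | _ k ih =>
    by_cases h : ∀ i < r, F (root i) ≠ -1
    · exact ⟨1, one_mem _, _, Finset.filter_subset _ _, by
        rw [act_one]; exact A.eq_face F hF h⟩
    · push Not at h
      obtain ⟨i, hi, hneg⟩ := h
      have hs : s i ∈ genSubgroup s (Set.Iio r) := gen_mem_genSubgroup hi
      have hinv : (s i)⁻¹ = s i := inv_eq_of_mul_eq_one_left (A.sq i hi)
      have hss : ∀ β : ι, s i • s i • β = β := fun β => by rw [← mul_smul, A.sq i hi, one_smul]
      have hlt : (Finset.univ.filter fun β => face ∅ β = 1 ∧ act (s i) F β = -1).card < k := by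
        rw [← hk]
        refine lt_of_le_of_lt (Finset.card_le_card_of_injOn (s i • ·) (t :=
          (Finset.univ.filter fun β => face ∅ β = 1 ∧ F β = -1).erase (root i)) ?_
          ((MulAction.injective (s i)).injOn)) (Finset.card_erase_lt_of_mem ?_)
        · intro β hβ
          simp only [Finset.coe_filter, Finset.mem_univ, true_and, Set.mem_ofPred_eq,
            act_apply, hinv] at hβ
          obtain ⟨hβ1, hβ2⟩ := hβ
          have hne : s i • β ≠ root i := by
            intro he
            have h1 := A.neg_root i hi _ (A.face_mem ∅)
            rw [← he, hss, he, hβ1, A.face_root ∅ i hi] at h1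
            simp at h1
          simp only [Finset.coe_erase, Finset.coe_filter, Finset.mem_univ, true_and,
            Set.mem_sdiff, Set.mem_ofPred_eq, Set.mem_singleton_iff, hβ2, and_true, hne,
            not_false_eq_true]
          have h0 : face ∅ (s i • β) ≠ 0 := A.ne_zero_gen i hi β (by rw [hβ1]; decide)
          rcases eq_one_or_neg_one h0 with h1 | h1
          · exact h1
          · exfalso
            have h2 := A.simple i hi β hβ1 h1 (act (s i) F) (A.act_mem hs hF)
            rw [act_apply, act_apply, hinv, hβ2, A.neg_root i hi F hF, hneg] at h2
            revert h2; decide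
        · simp [hneg, A.face_root ∅ i hi]
      obtain ⟨w, hw, J, hJ, hwJ⟩ := ih _ hlt (A.act_mem hs hF) rfl
      refine ⟨(s i)⁻¹ * w, mul_mem (inv_mem hs) hw, J, hJ, ?_⟩
      rw [act_mul, ← hwJ, eq_comm, act_inv_eq]

end Arrangement

/-! ### Descent algebras and invariants of face algebras -/

section Algebra

variable {Γ ι : Type*} [Group Γ] [MulAction Γ ι]

/-- The sum of the minimal length left coset representatives of a parabolic subgroup. -/
noncomputable def repSum [Fintype Γ] (s : ℕ → Γ) (r : ℕ) (J : Set ℕ) : MonoidAlgebra ℚ Γ :=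
  ∑ w : Γ, if w ∈ minReps s r J then MonoidAlgebra.of ℚ Γ w else 0

/-- The descent algebra. -/
noncomputable def descentAlg [Fintype Γ] (s : ℕ → Γ) (r : ℕ) : Subalgebra ℚ (MonoidAlgebra ℚ Γ) :=
  Algebra.adjoin ℚ {a | ∃ J ⊆ Set.Iio r, a = repSum s r J}

/-- The invariants of the face algebra. -/
noncomputable def invAlg (s : ℕ → Γ) (r : ℕ) (faces : Submonoid (SignVec ι)) :
    Subalgebra ℚ (MonoidAlgebra ℚ (SignVec ι)) where
  carrier := {a | a ∈ (MonoidAlgebra.mapDomainAlgHom ℚ ℚ faces.subtype).range ∧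
    ∀ g ∈ genSubgroup s (Set.Iio r), MonoidAlgebra.mapDomainAlgHom ℚ ℚ (act g) a = a}
  mul_mem' := fun ha hb => ⟨mul_mem ha.1 hb.1, fun g hg => by
    rw [map_mul, ha.2 g hg, hb.2 g hg]⟩
  add_mem' := fun ha hb => ⟨add_mem ha.1 hb.1, fun g hg => by
    rw [map_add, ha.2 g hg, hb.2 g hg]⟩
  algebraMap_mem' := fun c => ⟨algebraMap_mem _ c, fun g _ => AlgHom.commutes _ c⟩

lemma mapDomainAlgHom_apply_single {M N : Type*} [Monoid M] [Monoid N] (f : M →* N) (m : M)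
    (c : ℚ) : MonoidAlgebra.mapDomainAlgHom ℚ ℚ f (MonoidAlgebra.single m c) =
      MonoidAlgebra.single (f m) c :=
  MonoidAlgebra.mapDomain_single

lemma coeff_mapDomainAlgHom_apply {M N : Type*} [Monoid M] [Monoid N] {f : M →* N}
    (hf : Function.Injective f) (a : MonoidAlgebra ℚ M) (m : M) :
    (MonoidAlgebra.mapDomainAlgHom ℚ ℚ f a).coeff (f m) = a.coeff m :=
  Finsupp.mapDomain_apply hf _ _

lemma mem_invAlg_iff {s : ℕ → Γ} {r : ℕ} {faces : Submonoid (SignVec ι)}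
    {a : MonoidAlgebra ℚ (SignVec ι)} :
    a ∈ invAlg s r faces ↔ (∀ F ∉ faces, a.coeff F = 0) ∧
      ∀ g ∈ genSubgroup s (Set.Iio r), ∀ F, a.coeff (act g F) = a.coeff F := by
  refine and_congr ⟨?_, fun h => ?_⟩
    (forall₂_congr fun g _ => ⟨fun h F => ?_, fun h => ?_⟩)
  · rintro ⟨b, rfl⟩ F hF
    exact Finsupp.mapDomain_of_notMem_range _ _ (by simpa using hF)
  · rw [← MonoidAlgebra.sum_coeff_single a]
    refine sum_mem fun F hF => ?_
    have hF : F ∈ faces := by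
      by_contra hF'
      exact (Finsupp.mem_support_iff.1 hF) (h F hF')
    exact ⟨MonoidAlgebra.single ⟨F, hF⟩ (a.coeff F), mapDomainAlgHom_apply_single _ _ _⟩
  · conv_lhs => rw [← h]
    exact coeff_mapDomainAlgHom_apply (act_injective g) a F
  · ext F
    obtain ⟨F', rfl⟩ : ∃ F', act g F' = F := ⟨act g⁻¹ F, by
      rw [← act_mul, mul_inv_cancel, act_one]⟩
    rw [coeff_mapDomainAlgHom_apply (act_injective g), h]

namespace Arrangement

variable {s : ℕ → Γ} {r : ℕ} {root : ℕ → ι} {faces : Submonoid (SignVec ι)}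
  {face : Finset ℕ → SignVec ι}

lemma invAlg_ext [Finite ι] (A : Arrangement s r root faces face)
    {a b : MonoidAlgebra ℚ (SignVec ι)} (ha : a ∈ invAlg s r faces) (hb : b ∈ invAlg s r faces)
    (h : ∀ J ⊆ Finset.range r, a.coeff (face J) = b.coeff (face J)) : a = b := by
  rw [mem_invAlg_iff] at ha hb
  ext F
  by_cases hF : F ∈ faces
  · obtain ⟨w, hw, J, hJ, rfl⟩ := A.exists_eq_act_face hF
    rw [ha.2 w hw, hb.2 w hw, h J hJ]
  · rw [ha.1 F hF, hb.1 F hF]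

/-- The orbit of a standard face. -/
noncomputable def orbit [Finite ι] (s : ℕ → Γ) (r : ℕ) (F : SignVec ι) : Finset (SignVec ι) :=
  Finset.univ.filter fun G => ∃ g ∈ genSubgroup s (Set.Iio r), act g F = G

/-- The sum of the orbit of a standard face. -/
noncomputable def orbitSum [Finite ι] (s : ℕ → Γ) (r : ℕ) (F : SignVec ι) :
    MonoidAlgebra ℚ (SignVec ι) :=
  ∑ G ∈ orbit s r F, MonoidAlgebra.single G 1

lemma mem_orbit [Finite ι] {F G : SignVec ι} :
    G ∈ orbit s r F ↔ ∃ g ∈ genSubgroup s (Set.Iio r), act g F = G := by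
  simp [orbit]

lemma coeff_orbitSum [Finite ι] (F G : SignVec ι) :
    (orbitSum s r F).coeff G = if G ∈ orbit s r F then 1 else 0 := by
  simp only [orbitSum, MonoidAlgebra.coeff_sum, Finsupp.finsetSum_apply,
    MonoidAlgebra.coeff_single, Finsupp.single_apply]
  exact Finset.sum_ite_eq' _ _ _

lemma orbitSum_mem [Finite ι] (A : Arrangement s r root faces face) {F : SignVec ι}
    (hF : F ∈ faces) : orbitSum s r F ∈ invAlg s r faces := by
  rw [mem_invAlg_iff]
  refine ⟨fun G hG => ?_, fun g hg G => ?_⟩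
  · rw [coeff_orbitSum, if_neg]
    rw [mem_orbit]
    rintro ⟨g, hg, rfl⟩
    exact hG (A.act_mem hg hF)
  · simp only [coeff_orbitSum, mem_orbit]
    congr 1
    refine propext ⟨?_, ?_⟩
    · rintro ⟨h, hh, he⟩
      refine ⟨g⁻¹ * h, mul_mem (inv_mem hg) hh, ?_⟩
      rw [act_mul, he, ← act_mul, inv_mul_cancel, act_one]
    · rintro ⟨h, hh, rfl⟩
      exact ⟨g * h, mul_mem hg hh, act_mul _ _ _⟩

lemma eq_act_face_of_mem_minReps (A : Arrangement s r root faces face) {J : Finset ℕ}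
    (hJ : J ⊆ Finset.range r) {w : Γ} (hw : w ∈ genSubgroup s (Set.Iio r)) :
    ∃ v ∈ minReps s r (J : Set ℕ), act v (face J) = act w (face J) := by
  obtain ⟨u, hu, hwu⟩ := exists_mul_mem_minReps (J := (J : Set ℕ))
    (fun j hj => by simpa using hJ hj) hw
  exact ⟨_, hwu, by rw [act_mul, A.act_face hJ hu]⟩

lemma act_face_mul_of_mem_minReps (A : Arrangement s r root faces face) {J : Finset ℕ}
    (hJ : J ⊆ Finset.range r) {w : Γ} (hw : w ∈ minReps s r (J : Set ℕ)) :
    act w (face J) * face ∅ = act w (face ∅) :=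
  have h := (A.mem_minReps_iff hJ).1 hw
  A.act_face_mul h.1 h.2

lemma face_mem_orbit_iff [Finite ι] (A : Arrangement s r root faces face) {J K : Finset ℕ}
    (hJ : J ⊆ Finset.range r) (hK : K ⊆ Finset.range r) :
    face K ∈ orbit s r (face J) ↔ K = J := by
  rw [mem_orbit]
  refine ⟨?_, fun h => ⟨1, one_mem _, by rw [act_one, h]⟩⟩
  rintro ⟨g, hg, he⟩
  obtain ⟨w, hw, hwe⟩ := A.eq_act_face_of_mem_minReps hJ hg
  have h1 := A.act_face_mul_of_mem_minReps hJ hw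
  have h2 : face K * face ∅ = face ∅ := by
    refine A.eq_face_empty (mul_mem (A.face_mem K) (A.face_mem ∅)) fun i hi => ?_
    rw [mul_apply, A.face_root K i hi, A.face_root ∅ i hi]
    by_cases h : i ∈ K <;> simp [h]
  rw [hwe, he, h2] at h1
  obtain rfl := A.eq_one_of_act_eq hw.1 h1.symm
  rw [← hwe, act_one] at he
  ext i
  by_cases hi : i < r
  · have h3 := A.face_root K i hi
    rw [← he, A.face_root J i hi] at h3
    by_cases hiJ : i ∈ J <;> by_cases hiK : i ∈ K <;> simp [hiJ, hiK] at h3 ⊢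
  · exact ⟨fun h => absurd (Finset.mem_range.1 (hK h)) hi,
      fun h => absurd (Finset.mem_range.1 (hJ h)) hi⟩

lemma eq_sum_orbitSum [Finite ι] (A : Arrangement s r root faces face)
    {a : MonoidAlgebra ℚ (SignVec ι)} (ha : a ∈ invAlg s r faces) :
    a = ∑ J ∈ (Finset.range r).powerset, a.coeff (face J) • orbitSum s r (face J) := by
  refine A.invAlg_ext ha (sum_mem fun J _ => (invAlg s r faces).smul_mem
    (A.orbitSum_mem (A.face_mem J)) _) fun K hK => ?_
  rw [MonoidAlgebra.coeff_sum, Finsupp.finsetSum_apply, Finset.sum_eq_single K]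
  · rw [MonoidAlgebra.coeff_smul_apply, coeff_orbitSum,
      if_pos ((A.face_mem_orbit_iff hK hK).2 rfl), smul_eq_mul, mul_one]
  · intro J hJ hne
    rw [MonoidAlgebra.coeff_smul_apply, coeff_orbitSum, if_neg, smul_zero]
    rw [A.face_mem_orbit_iff (Finset.mem_powerset.1 hJ) hK]
    exact hne.symm
  · intro h
    exact absurd (Finset.mem_powerset.2 hK) h

lemma orbitSum_eq [Finite ι] [Fintype Γ] (A : Arrangement s r root faces face) {J : Finset ℕ}
    (hJ : J ⊆ Finset.range r) :
    orbitSum s r (face J) = ∑ w : Γ, if w ∈ minReps s r (J : Set ℕ) then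
      MonoidAlgebra.single (act w (face J)) 1 else 0 := by
  rw [← Finset.sum_filter, orbitSum]
  have : orbit s r (face J) =
      (Finset.univ.filter (· ∈ minReps s r (J : Set ℕ))).image fun w => act w (face J) := by
    ext G
    simp only [mem_orbit, Finset.mem_image, Finset.mem_filter, Finset.mem_univ, true_and]
    constructor
    · rintro ⟨g, hg, rfl⟩
      exact A.eq_act_face_of_mem_minReps hJ hg
    · rintro ⟨w, hw, rfl⟩
      exact ⟨w, hw.1, rfl⟩
  rw [this, Finset.sum_image]
  intro v hv w hw h
  simp only [Finset.coe_filter, Finset.mem_univ, true_and, Set.mem_ofPred_eq] at hv hw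
  refine A.eq_of_act_eq hv.1 hw.1 ?_
  rw [← A.act_face_mul_of_mem_minReps hJ hv, ← A.act_face_mul_of_mem_minReps hJ hw]
  exact congrArg (· * face ∅) h

/-- The linear map sending a group element to the corresponding chamber. -/
noncomputable def chamberMap (C : SignVec ι) :
    MonoidAlgebra ℚ Γ →ₗ[ℚ] MonoidAlgebra ℚ (SignVec ι) :=
  MonoidAlgebra.mapDomainLinearMap ℚ ℚ fun w => act w C

lemma chamberMap_single (C : SignVec ι) (w : Γ) (c : ℚ) :
    chamberMap C (MonoidAlgebra.single w c) = MonoidAlgebra.single (act w C) c :=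
  MonoidAlgebra.mapDomain_single

/-- The elements of the group algebra supported on the group generated by the `s i`. -/
noncomputable def grpAlg (s : ℕ → Γ) (r : ℕ) : Subalgebra ℚ (MonoidAlgebra ℚ Γ) :=
  (MonoidAlgebra.mapDomainAlgHom ℚ ℚ (genSubgroup s (Set.Iio r)).subtype).range

lemma single_mem_grpAlg {w : Γ} (hw : w ∈ genSubgroup s (Set.Iio r)) (c : ℚ) :
    MonoidAlgebra.single w c ∈ grpAlg s r :=
  ⟨MonoidAlgebra.single ⟨w, hw⟩ c, mapDomainAlgHom_apply_single _ _ _⟩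

lemma eq_of_eq_on_grpAlg {V : Type*} [AddCommGroup V] [Module ℚ V]
    {f g : MonoidAlgebra ℚ Γ →ₗ[ℚ] V}
    (h : ∀ w ∈ genSubgroup s (Set.Iio r), f (MonoidAlgebra.single w 1) =
      g (MonoidAlgebra.single w 1)) {x : MonoidAlgebra ℚ Γ} (hx : x ∈ grpAlg s r) :
    f x = g x := by
  obtain ⟨y, rfl⟩ := hx
  induction y using MonoidAlgebra.induction_linear with
  | zero => simp
  | add y z hy hz => rw [map_add, map_add, map_add, hy, hz]
  | single w c =>
    have := congrArg (c • ·) (h w w.2)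
    simp only [← map_smul, MonoidAlgebra.smul_single, smul_eq_mul, mul_one] at this
    have e : MonoidAlgebra.mapDomainAlgHom ℚ ℚ (genSubgroup s (Set.Iio r)).subtype
      (MonoidAlgebra.single w c) = MonoidAlgebra.single (w : Γ) c :=
      mapDomainAlgHom_apply_single _ _ _
    exact e ▸ this

lemma repSum_mem_grpAlg [Fintype Γ] (J : Set ℕ) : repSum s r J ∈ grpAlg s r := by
  refine sum_mem fun w _ => ?_
  split_ifs with h
  · exact single_mem_grpAlg h.1 1
  · exact zero_mem _

lemma chamberMap_injOn (A : Arrangement s r root faces face) {x y : MonoidAlgebra ℚ Γ}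
    (hx : x ∈ grpAlg s r) (hy : y ∈ grpAlg s r)
    (h : chamberMap (face ∅) x = chamberMap (face ∅) y) : x = y := by
  let p : SignVec ι → Γ := fun F =>
    if h : ∃ w ∈ genSubgroup s (Set.Iio r), act w (face ∅) = F then h.choose else 1
  have hp : ∀ w ∈ genSubgroup s (Set.Iio r), p (act w (face ∅)) = w := by
    intro w hw
    have hex : ∃ v ∈ genSubgroup s (Set.Iio r), act v (face ∅) = act w (face ∅) := ⟨w, hw, rfl⟩
    rw [show p (act w (face ∅)) = hex.choose from dif_pos hex]
    exact A.eq_of_act_eq hex.choose_spec.1 hw hex.choose_spec.2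
  have key : ∀ z ∈ grpAlg s r,
      ((MonoidAlgebra.mapDomainLinearMap ℚ ℚ p).comp (chamberMap (face ∅))) z =
        LinearMap.id (R := ℚ) z := by
    intro z hz
    refine eq_of_eq_on_grpAlg (fun w hw => ?_) hz
    rw [LinearMap.comp_apply, chamberMap_single, LinearMap.id_apply,
      MonoidAlgebra.mapDomainLinearMap_single, hp w hw]
  have hx' := key x hx
  have hy' := key y hy
  rw [LinearMap.comp_apply] at hx' hy'
  rw [h, hy'] at hx'
  exact hx'.symm

/-- The linear map from the face algebra to the group algebra, which restricts to an
anti-isomorphism from the invariants to the descent algebra. -/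
noncomputable def toDescent [Fintype Γ] (s : ℕ → Γ) (r : ℕ) (face : Finset ℕ → SignVec ι)
    (a : MonoidAlgebra ℚ (SignVec ι)) : MonoidAlgebra ℚ Γ :=
  ∑ J ∈ (Finset.range r).powerset, a.coeff (face J) • repSum s r (J : Set ℕ)

lemma toDescent_add [Fintype Γ] {κ : Type*} {φ : Finset ℕ → SignVec κ}
    (a b : MonoidAlgebra ℚ (SignVec κ)) :
    toDescent s r φ (a + b) = toDescent s r φ a + toDescent s r φ b := by
  simp [toDescent, add_smul, Finset.sum_add_distrib]

lemma toDescent_smul [Fintype Γ] {κ : Type*} {φ : Finset ℕ → SignVec κ}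
    (c : ℚ) (a : MonoidAlgebra ℚ (SignVec κ)) :
    toDescent s r φ (c • a) = c • toDescent s r φ a := by
  simp [toDescent, mul_smul, Finset.smul_sum]

lemma toDescent_mem_grpAlg [Fintype Γ] {κ : Type*} {φ : Finset ℕ → SignVec κ}
    (a : MonoidAlgebra ℚ (SignVec κ)) :
    toDescent s r φ a ∈ grpAlg s r :=
  sum_mem fun _ _ => (grpAlg s r).smul_mem (repSum_mem_grpAlg _) _

lemma toDescent_mem_descentAlg [Fintype Γ] {κ : Type*} {φ : Finset ℕ → SignVec κ}
    (a : MonoidAlgebra ℚ (SignVec κ)) :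
    toDescent s r φ a ∈ descentAlg s r :=
  sum_mem fun J hJ => (descentAlg s r).smul_mem (Algebra.subset_adjoin
    ⟨J, fun j hj => by simpa using Finset.mem_powerset.1 hJ hj, rfl⟩) _

lemma chamberMap_toDescent [Finite ι] [Fintype Γ] (A : Arrangement s r root faces face)
    {a : MonoidAlgebra ℚ (SignVec ι)} (ha : a ∈ invAlg s r faces) :
    chamberMap (face ∅) (toDescent s r face a) = a * MonoidAlgebra.single (face ∅) 1 := by
  conv_rhs => rw [A.eq_sum_orbitSum ha]
  rw [toDescent, map_sum, Finset.sum_mul]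
  refine Finset.sum_congr rfl fun J hJ => ?_
  rw [Finset.mem_powerset] at hJ
  rw [map_smul, smul_mul_assoc, A.orbitSum_eq hJ, repSum, map_sum, Finset.sum_mul]
  congr 1
  refine Finset.sum_congr rfl fun w _ => ?_
  split_ifs with hw
  · rw [MonoidAlgebra.of_apply, chamberMap_single, MonoidAlgebra.single_mul_single, mul_one,
      A.act_face_mul_of_mem_minReps hJ hw]
  · rw [map_zero, zero_mul]

lemma mul_chamberMap [Finite ι] [Fintype Γ] (A : Arrangement s r root faces face)
    {a : MonoidAlgebra ℚ (SignVec ι)} (ha : a ∈ invAlg s r faces) {x : MonoidAlgebra ℚ Γ}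
    (hx : x ∈ grpAlg s r) :
    a * chamberMap (face ∅) x = chamberMap (face ∅) (x * toDescent s r face a) := by
  refine eq_of_eq_on_grpAlg (f := (LinearMap.mulLeft ℚ a).comp (chamberMap (face ∅)))
    (g := (chamberMap (face ∅)).comp (LinearMap.mulRight ℚ (toDescent s r face a)))
    (fun w hw => ?_) hx
  simp only [LinearMap.comp_apply, LinearMap.mulLeft_apply, LinearMap.mulRight_apply,
    chamberMap_single]
  have h1 : ∀ y : MonoidAlgebra ℚ Γ, chamberMap (face ∅) (MonoidAlgebra.single w 1 * y) =
      MonoidAlgebra.mapDomainAlgHom ℚ ℚ (act w) (chamberMap (face ∅) y) := by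
    intro y
    induction y using MonoidAlgebra.induction_linear with
    | zero => simp
    | add y z hy hz => rw [mul_add, map_add, map_add, map_add, hy, hz]
    | single v c =>
      rw [MonoidAlgebra.single_mul_single, chamberMap_single, chamberMap_single,
        mapDomainAlgHom_apply_single, act_mul, one_mul]
  rw [h1, A.chamberMap_toDescent ha, map_mul, ha.2 w hw, mapDomainAlgHom_apply_single]

lemma toDescent_mul [Finite ι] [Fintype Γ] (A : Arrangement s r root faces face)
    {a b : MonoidAlgebra ℚ (SignVec ι)} (ha : a ∈ invAlg s r faces) (hb : b ∈ invAlg s r faces) :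
    toDescent s r face (a * b) = toDescent s r face b * toDescent s r face a := by
  refine A.chamberMap_injOn (toDescent_mem_grpAlg _)
    (mul_mem (toDescent_mem_grpAlg _) (toDescent_mem_grpAlg _)) ?_
  rw [A.chamberMap_toDescent (mul_mem ha hb), mul_assoc, ← A.chamberMap_toDescent hb,
    A.mul_chamberMap ha (toDescent_mem_grpAlg _)]

lemma toDescent_one [Finite ι] [Fintype Γ] (A : Arrangement s r root faces face) :
    toDescent s r face (1 : MonoidAlgebra ℚ (SignVec ι)) = 1 := by
  refine A.chamberMap_injOn (toDescent_mem_grpAlg _) (one_mem _) ?_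
  rw [A.chamberMap_toDescent (one_mem _), one_mul, MonoidAlgebra.one_def, chamberMap_single,
    act_one]

lemma toDescent_orbitSum [Finite ι] [Fintype Γ] (A : Arrangement s r root faces face)
    {J : Finset ℕ} (hJ : J ⊆ Finset.range r) :
    toDescent s r face (orbitSum s r (face J)) = repSum s r (J : Set ℕ) := by
  rw [toDescent, Finset.sum_eq_single J]
  · rw [coeff_orbitSum, if_pos ((A.face_mem_orbit_iff hJ hJ).2 rfl), one_smul]
  · intro K hK hne
    rw [coeff_orbitSum, if_neg, zero_smul]
    rwa [A.face_mem_orbit_iff hJ (Finset.mem_powerset.1 hK)]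
  · intro h
    exact absurd (Finset.mem_powerset.2 hJ) h

lemma exists_finset_eq {J : Set ℕ} (hJ : J ⊆ Set.Iio r) :
    ∃ J' ⊆ Finset.range r, J = (J' : Set ℕ) := by
  refine ⟨(Finset.range r).filter (· ∈ J), Finset.filter_subset _ _, ?_⟩
  ext j
  simpa using fun hj => hJ hj

lemma exists_toDescent_eq [Finite ι] [Fintype Γ] (A : Arrangement s r root faces face)
    {x : MonoidAlgebra ℚ Γ} (hx : x ∈ descentAlg s r) :
    ∃ a ∈ invAlg s r faces, toDescent s r face a = x := by
  induction hx using Algebra.adjoin_induction with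
  | mem x hx =>
    obtain ⟨J, hJ, rfl⟩ := hx
    obtain ⟨J, hJ', rfl⟩ := exists_finset_eq hJ
    exact ⟨_, A.orbitSum_mem (A.face_mem J), A.toDescent_orbitSum hJ'⟩
  | algebraMap c =>
    exact ⟨c • 1, (invAlg s r faces).smul_mem (one_mem _) c, by
      rw [toDescent_smul, A.toDescent_one, Algebra.algebraMap_eq_smul_one]⟩
  | add x y _ _ hx hy =>
    obtain ⟨a, ha, rfl⟩ := hx
    obtain ⟨b, hb, rfl⟩ := hy
    exact ⟨_, add_mem ha hb, toDescent_add _ _⟩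
  | mul x y _ _ hx hy =>
    obtain ⟨a, ha, rfl⟩ := hx
    obtain ⟨b, hb, rfl⟩ := hy
    exact ⟨_, mul_mem hb ha, A.toDescent_mul hb ha⟩

lemma exists_descent_eq [Finite ι] (A : Arrangement s r root faces face) (J : Finset ℕ) :
    ∃ w ∈ genSubgroup s (Set.Iio r),
      ∀ j < r, face ∅ (w • root j) = if j ∈ J then 1 else -1 := by
  obtain ⟨N, hN, hneg⟩ := A.exists_neg
  let F := face (Finset.range r \ J) * N * face ∅
  have hF : F ∈ faces := mul_mem (mul_mem (A.face_mem _) hN) (A.face_mem ∅)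
  have hFr : ∀ j < r, F (root j) = if j ∈ J then 1 else -1 := by
    intro j hj
    change (face (Finset.range r \ J) * N * face ∅) (root j) = _
    rw [mul_apply, mul_apply, A.face_root _ j hj, hneg j hj]
    by_cases h : j ∈ J <;> simp [h, hj]
  obtain ⟨w, hw, K, hK, he⟩ := A.exists_eq_act_face hF
  obtain rfl : K = ∅ := by
    by_contra hne
    obtain ⟨k, hk⟩ := Finset.nonempty_iff_ne_empty.2 hne
    have hkr : k < r := Finset.mem_range.1 (hK hk)
    have h1 : F (w • root k) = 0 := by
      rw [he, act_apply, inv_smul_smul, A.face_root K k hkr, if_pos hk]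
    change (face (Finset.range r \ J) * N * face ∅) (w • root k) = 0 at h1
    rw [mul_apply] at h1
    split_ifs at h1 with h2
    · exact A.ne_zero hw hkr h1
    · exact h2 h1
  refine ⟨w⁻¹, inv_mem hw, fun j hj => ?_⟩
  have h := congrFun he (root j)
  rw [hFr j hj, act_apply] at h
  exact h.symm

lemma toDescent_injOn [Finite ι] [Fintype Γ] (A : Arrangement s r root faces face)
    {a : MonoidAlgebra ℚ (SignVec ι)} (ha : a ∈ invAlg s r faces)
    (h0 : toDescent s r face a = 0) : a = 0 := by
  refine A.invAlg_ext ha (zero_mem _) fun J hJ => ?_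
  rw [MonoidAlgebra.coeff_zero, Finsupp.zero_apply]
  induction J using Finset.strongInduction with
  | H J ih =>
    obtain ⟨w, hw, hd⟩ := A.exists_descent_eq J
    have hmem : ∀ K ⊆ Finset.range r, w ∈ minReps s r (K : Set ℕ) ↔ K ⊆ J := by
      intro K hK
      rw [A.mem_minReps_iff hK, and_iff_right hw]
      refine forall₂_congr fun j hj => ?_
      rw [hd j (Finset.mem_range.1 (hK hj))]
      by_cases h : j ∈ J
      · simp [h]
      · simp only [h, if_false, iff_false]
        decide
    have hc : ∀ K ⊆ Finset.range r, (repSum s r (K : Set ℕ)).coeff w = if K ⊆ J then 1 else 0 := by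
      intro K hK
      rw [repSum, MonoidAlgebra.coeff_sum, Finsupp.finsetSum_apply, Finset.sum_eq_single w]
      · simp only [hmem K hK]
        split_ifs <;> simp
      · intro v _ hv
        split_ifs <;> simp [hv]
      · simp
    have h1 : (toDescent s r face a).coeff w = 0 := by rw [h0]; rfl
    rw [toDescent, MonoidAlgebra.coeff_sum, Finsupp.finsetSum_apply,
      Finset.sum_eq_single J] at h1
    · rwa [MonoidAlgebra.coeff_smul_apply, hc J hJ, if_pos le_rfl, smul_eq_mul, mul_one] at h1
    · intro K hK hne
      rw [Finset.mem_powerset] at hK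
      rw [MonoidAlgebra.coeff_smul_apply, hc K hK]
      split_ifs with hKJ
      · rw [ih K (lt_of_le_of_ne hKJ hne) hK, zero_smul]
      · rw [smul_zero]
    · intro h
      exact absurd (Finset.mem_powerset.2 hJ) h

end Arrangement

end Algebra

section Transfer

variable {Γ ι Γ' ι' : Type*} [Group Γ] [MulAction Γ ι] [Group Γ'] [MulAction Γ' ι'] [Fintype Γ]
  [Fintype Γ'] [Finite ι] [Finite ι'] {s : ℕ → Γ} {r : ℕ} {root : ℕ → ι}
  {faces : Submonoid (SignVec ι)} {face : Finset ℕ → SignVec ι} {s' : ℕ → Γ'} {r' : ℕ}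
  {root' : ℕ → ι'} {faces' : Submonoid (SignVec ι')} {face' : Finset ℕ → SignVec ι'}

lemma exists_descentAlg_hom (A : Arrangement s r root faces face)
    (A' : Arrangement s' r' root' faces' face')
    (ρ : MonoidAlgebra ℚ (SignVec ι) →ₐ[ℚ] MonoidAlgebra ℚ (SignVec ι'))
    (hρ : ∀ a ∈ invAlg s r faces, ρ a ∈ invAlg s' r' faces') :
    ∃ φ : descentAlg s r →ₐ[ℚ] descentAlg s' r', ∀ a ∈ invAlg s r faces, ∀ x : descentAlg s r,
      Arrangement.toDescent s r face a = x →
        (φ x : MonoidAlgebra ℚ Γ') = Arrangement.toDescent s' r' face' (ρ a) := by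
  choose f hf hfx using fun x : descentAlg s r => A.exists_toDescent_eq x.2
  have huniq : ∀ a ∈ invAlg s r faces, ∀ x : descentAlg s r,
      Arrangement.toDescent s r face a = x → f x = a := by
    intro a ha x hx
    rw [← sub_eq_zero]
    refine A.toDescent_injOn (sub_mem (hf x) ha) ?_
    rw [sub_eq_add_neg, ← neg_one_smul ℚ a, Arrangement.toDescent_add,
      Arrangement.toDescent_smul, hfx, hx, neg_one_smul, add_neg_cancel]
  refine ⟨AlgHom.ofLinearMap
    { toFun := fun x => ⟨Arrangement.toDescent s' r' face' (ρ (f x)),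
        Arrangement.toDescent_mem_descentAlg _⟩
      map_add' := fun x y => Subtype.ext ?_
      map_smul' := fun c x => Subtype.ext ?_ } (Subtype.ext ?_) (fun x y => Subtype.ext ?_),
      fun a ha x hx => ?_⟩
  · change Arrangement.toDescent s' r' face' (ρ (f (x + y))) = _ + _
    rw [huniq _ (add_mem (hf x) (hf y)) (x + y)
      (by rw [Arrangement.toDescent_add, hfx, hfx]; rfl), map_add, Arrangement.toDescent_add]
  · change Arrangement.toDescent s' r' face' (ρ (f (c • x))) = c • _
    rw [huniq _ ((invAlg s r faces).smul_mem (hf x) c) (c • x)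
      (by rw [Arrangement.toDescent_smul, hfx]; rfl), map_smul, Arrangement.toDescent_smul]
  · change Arrangement.toDescent s' r' face' (ρ (f 1)) = 1
    rw [huniq 1 (one_mem _) 1 (by rw [A.toDescent_one]; rfl), map_one, A'.toDescent_one]
  · change Arrangement.toDescent s' r' face' (ρ (f (x * y))) = _ * _
    rw [huniq _ (mul_mem (hf y) (hf x)) (x * y)
      (by rw [A.toDescent_mul (hf y) (hf x), hfx, hfx]; rfl), map_mul,
      A'.toDescent_mul (hρ _ (hf y)) (hρ _ (hf x))]
    rfl
  · change Arrangement.toDescent s' r' face' (ρ (f x)) = _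
    rw [huniq a ha x hx]

lemma exists_descentAlg_equiv_quotient (A : Arrangement s r root faces face)
    (A' : Arrangement s' r' root' faces' face')
    (ρ : MonoidAlgebra ℚ (SignVec ι) →ₐ[ℚ] MonoidAlgebra ℚ (SignVec ι'))
    (hρ : ∀ a ∈ invAlg s r faces, ρ a ∈ invAlg s' r' faces') (lift : Finset ℕ → Finset ℕ)
    (hlift : ∀ K ⊆ Finset.range r', lift K ⊆ Finset.range r)
    (hinj : Function.Injective lift)
    (hcoeff : ∀ a ∈ invAlg s r faces, ∀ K ⊆ Finset.range r',
      (ρ a).coeff (face' K) = a.coeff (face (lift K)))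
    (S : Set (descentAlg s r))
    (hS : ∀ x : descentAlg s r, x ∈ S ↔ ∃ J ⊆ Finset.range r,
      (∀ K ⊆ Finset.range r', lift K ≠ J) ∧ (x : MonoidAlgebra ℚ Γ) = repSum s r (J : Set ℕ)) :
    ∃ e : ↥(descentAlg s' r') ≃+* (TwoSidedIdeal.span S).ringCon.Quotient,
      ∀ (c : ℚ) (x : ↥(descentAlg s' r')), e (c • x) = c • e x := by
  obtain ⟨φ, hφ⟩ := exists_descentAlg_hom A A' ρ hρ
  have hsurj : Function.Surjective φ := by
    intro y
    obtain ⟨b, hb, hby⟩ := A'.exists_toDescent_eq y.2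
    let a : MonoidAlgebra ℚ (SignVec ι) := ∑ K ∈ (Finset.range r').powerset,
      b.coeff (face' K) • Arrangement.orbitSum s r (face (lift K))
    have ha : a ∈ invAlg s r faces := sum_mem fun _ _ =>
      (invAlg s r faces).smul_mem (A.orbitSum_mem (A.face_mem _)) _
    refine ⟨⟨_, Arrangement.toDescent_mem_descentAlg (φ := face) a⟩, Subtype.ext ?_⟩
    rw [hφ a ha _ rfl, ← hby]
    congr 1
    refine A'.invAlg_ext (hρ a ha) hb fun K hK => ?_
    rw [hcoeff a ha K hK, MonoidAlgebra.coeff_sum, Finsupp.finsetSum_apply,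
      Finset.sum_eq_single K]
    · rw [MonoidAlgebra.coeff_smul_apply, Arrangement.coeff_orbitSum,
        if_pos ((A.face_mem_orbit_iff (hlift K hK) (hlift K hK)).2 rfl), smul_eq_mul, mul_one]
    · intro L hL hne
      rw [MonoidAlgebra.coeff_smul_apply, Arrangement.coeff_orbitSum, if_neg, smul_zero]
      rw [A.face_mem_orbit_iff (hlift L (Finset.mem_powerset.1 hL)) (hlift K hK)]
      exact fun h => hne (hinj h).symm
    · intro h
      exact absurd (Finset.mem_powerset.2 hK) h
  have hker : ∀ x, φ x = 0 ↔ x ∈ TwoSidedIdeal.span S := by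
    intro x
    constructor
    · intro hx
      obtain ⟨a, ha, hax⟩ := A.exists_toDescent_eq x.2
      have h0 : ρ a = 0 := by
        refine A'.toDescent_injOn (hρ a ha) ?_
        rw [← hφ a ha x hax, hx]
        rfl
      let R : Finset ℕ → descentAlg s r := fun J => ⟨_,
        Arrangement.toDescent_mem_descentAlg (φ := face) (Arrangement.orbitSum s r (face J))⟩
      have hx' : x = ∑ J ∈ (Finset.range r).powerset,
          algebraMap ℚ (descentAlg s r) (a.coeff (face J)) * R J := by
        refine Subtype.ext ?_
        rw [← hax, Arrangement.toDescent, AddSubmonoidClass.coe_finsetSum]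
        refine Finset.sum_congr rfl fun J hJ => ?_
        rw [← A.toDescent_orbitSum (Finset.mem_powerset.1 hJ), Algebra.smul_def]
        rfl
      rw [hx']
      refine sum_mem fun J hJ => ?_
      rw [Finset.mem_powerset] at hJ
      by_cases h : ∃ K ⊆ Finset.range r', lift K = J
      · obtain ⟨K, hK, rfl⟩ := h
        rw [← hcoeff a ha K hK, h0, MonoidAlgebra.coeff_zero, Finsupp.zero_apply, map_zero,
          zero_mul]
        exact zero_mem _
      · push Not at h
        refine TwoSidedIdeal.mul_mem_left _ _ _ (TwoSidedIdeal.subset_span ?_)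
        exact (hS _).2 ⟨J, hJ, h, A.toDescent_orbitSum hJ⟩
    · intro hx
      rw [← TwoSidedIdeal.mem_ker]
      refine TwoSidedIdeal.span_le.2 ?_ hx
      intro y hy
      obtain ⟨J, hJ, hJK, hyJ⟩ := (hS y).1 hy
      rw [SetLike.mem_coe, TwoSidedIdeal.mem_ker]
      refine Subtype.ext ?_
      have ha := A.orbitSum_mem (A.face_mem J)
      rw [hφ _ ha y (by rw [hyJ, A.toDescent_orbitSum hJ])]
      rw [show ρ (Arrangement.orbitSum s r (face J)) = 0 from ?_]
      · simp [Arrangement.toDescent]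
      · refine A'.invAlg_ext (hρ _ ha) (zero_mem _) fun K hK => ?_
        rw [hcoeff _ ha K hK, Arrangement.coeff_orbitSum, if_neg]
        · rfl
        · rw [A.face_mem_orbit_iff hJ (hlift K hK)]
          exact hJK K hK
  have hcon : (TwoSidedIdeal.span S).ringCon =
      RingCon.ker (φ : descentAlg s r →+* descentAlg s' r') := by
    ext x y
    rw [TwoSidedIdeal.rel_iff, ← hker, map_sub, sub_eq_zero]
    rfl
  rw [hcon]
  let e := RingCon.quotientKerEquivOfSurjective (φ : descentAlg s r →+* descentAlg s' r') hsurj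
  have he : ∀ y : descentAlg s r, e.symm (φ y) = (y : (RingCon.ker _).Quotient) := fun y =>
    e.symm_apply_eq.2 rfl
  refine ⟨e.symm, fun c x => ?_⟩
  obtain ⟨y, rfl⟩ := hsurj x
  rw [← map_smul, he, he, RingCon.coe_smul]

end Transfer

/-! ### Arrangements of signed permutations -/

section Signed

variable {Ω : Type*} {neg : Ω → Ω} {Φ : Ω → Ω → Prop}

/-- The sign vector of a point: the signs of the differences `y a - y b`, where `(a, b)` ranges
over the pairs satisfying `Φ`. -/
noncomputable def signVec (Φ : Ω → Ω → Prop) (y : Ω → ℤ) : SignVec (Ω × Ω) :=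
  fun c => if Φ c.1 c.2 then SignType.sign (y c.1 - y c.2) else 0

lemma signVec_apply (y : Ω → ℤ) (a b : Ω) :
    signVec Φ y (a, b) = if Φ a b then SignType.sign (y a - y b) else 0 := rfl

lemma sign_nsmul_add {N u v : ℤ} (h : |v| < N) :
    SignType.sign (N * u + v) =
      if SignType.sign u = 0 then SignType.sign v else SignType.sign u := by
  have hN : 0 < N := lt_of_le_of_lt (abs_nonneg v) h
  rw [abs_lt] at h
  rcases lt_trichotomy u 0 with hu | rfl | hu
  · rw [sign_neg hu, sign_neg (by nlinarith)]; rfl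
  · simp
  · rw [sign_pos hu, sign_pos (by nlinarith)]; rfl

lemma signVec_mul [Finite Ω] (y z : Ω → ℤ) :
    ∃ N : ℤ, signVec Φ y * signVec Φ z = signVec Φ fun c => N * y c + z c := by
  have := Fintype.ofFinite Ω
  refine ⟨1 + 2 * ∑ c, |z c|, ?_⟩
  ext ⟨a, b⟩
  rw [mul_apply, signVec_apply, signVec_apply, signVec_apply]
  by_cases h : Φ a b
  · have hle : ∀ c, |z c| ≤ ∑ c, |z c| := fun c =>
      Finset.single_le_sum (f := fun c => |z c|) (fun _ _ => abs_nonneg _) (Finset.mem_univ c)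
    have hlt : |z a - z b| < 1 + 2 * ∑ c, |z c| := by
      have := abs_sub (z a) (z b)
      linarith [hle a, hle b]
    rw [if_pos h, if_pos h, if_pos h, ← sign_nsmul_add hlt]
    congr 1
    ring
  · simp [h]

/-- The sign vectors of the odd points. -/
def pointFaces [Finite Ω] (neg : Ω → Ω) (Φ : Ω → Ω → Prop) : Submonoid (SignVec (Ω × Ω)) where
  carrier := {F | ∃ y : Ω → ℤ, (∀ c, y (neg c) = -y c) ∧ F = signVec Φ y}
  mul_mem' := by
    rintro _ _ ⟨y, hy, rfl⟩ ⟨z, hz, rfl⟩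
    obtain ⟨N, hN⟩ := signVec_mul (Φ := Φ) y z
    exact ⟨_, fun c => by rw [hy, hz]; ring, hN⟩
  one_mem' := ⟨0, by simp, by
    ext ⟨a, b⟩
    simp [signVec_apply, SignVec.one_apply]⟩

/-- The permutation `g` acts as the reflection exchanging `c.1` with `c.2` and their opposites. -/
structure IsReflection (neg : Ω → Ω) (g : Equiv.Perm Ω) (c : Ω × Ω) : Prop where
  fst : g c.1 = c.2
  snd : g c.2 = c.1
  neg_fst : g (neg c.1) = neg c.2
  neg_snd : g (neg c.2) = neg c.1
  fix : ∀ a, a ≠ c.1 → a ≠ c.2 → a ≠ neg c.1 → a ≠ neg c.2 → g a = a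

/-- The pair obtained by exchanging the opposites of the components. -/
def dualPair (neg : Ω → Ω) (c : Ω × Ω) : Ω × Ω := (neg c.2, neg c.1)

namespace IsReflection

variable {g : Equiv.Perm Ω} {c : Ω × Ω}

lemma dual (hneg : Function.Involutive neg) (h : IsReflection neg g c) :
    IsReflection neg g (dualPair neg c) where
  fst := h.neg_snd
  snd := h.neg_fst
  neg_fst := by simp [dualPair, hneg c.1, hneg c.2, h.snd]
  neg_snd := by simp [dualPair, hneg c.1, hneg c.2, h.fst]
  fix a h1 h2 h3 h4 := by
    simp only [dualPair, hneg c.1, hneg c.2] at h1 h2 h3 h4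
    exact h.fix a h4 h3 h2 h1

lemma cases_mem (h : IsReflection neg g c) {P : Ω → Ω → Prop} (h1 : P c.1 c.2) (h2 : P c.2 c.1)
    (h3 : P (neg c.1) (neg c.2)) (h4 : P (neg c.2) (neg c.1)) (h5 : ∀ a, a ≠ c.1 → a ≠ c.2 →
      a ≠ neg c.1 → a ≠ neg c.2 → P a a) (a : Ω) : P a (g a) := by
  by_cases e1 : a = c.1
  · rw [e1, h.fst]; exact h1
  by_cases e2 : a = c.2
  · rw [e2, h.snd]; exact h2
  by_cases e3 : a = neg c.1
  · rw [e3, h.neg_fst]; exact h3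
  by_cases e4 : a = neg c.2
  · rw [e4, h.neg_snd]; exact h4
  rw [h.fix a e1 e2 e3 e4]
  exact h5 a e1 e2 e3 e4

lemma mul_self (h : IsReflection neg g c) : g * g = 1 := by
  ext a
  change g (g a) = a
  exact h.cases_mem (P := fun a b => g b = a) h.snd h.fst h.neg_snd h.neg_fst h.fix a

lemma map_neg (hneg : Function.Involutive neg) (h : IsReflection neg g c) (a : Ω) :
    g (neg a) = neg (g a) := by
  refine h.cases_mem (P := fun a b => g (neg a) = neg b) h.neg_fst h.neg_snd ?_ ?_ ?_ a
  · rw [hneg, hneg, h.fst]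
  · rw [hneg, hneg, h.snd]
  · intro a h1 h2 h3 h4
    exact h.fix _ (fun e => h3 (by rw [← e, hneg])) (fun e => h4 (by rw [← e, hneg]))
      (fun e => h1 (hneg.injective e)) (fun e => h2 (hneg.injective e))

lemma map_eq_of_eq (h : IsReflection neg g c) {y : Ω → ℤ} (hy : ∀ c, y (neg c) = -y c)
    (he : y c.1 = y c.2) (a : Ω) : y (g a) = y a :=
  h.cases_mem (P := fun a b => y b = y a) he.symm he (by rw [hy, hy, he]) (by rw [hy, hy, he])
    (fun _ _ _ _ _ => rfl) a

lemma conj {g' u : Equiv.Perm Ω} (hu : ∀ a, u (neg a) = neg (u a))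
    (h : IsReflection neg g c) (h' : IsReflection neg g' (u • c)) : g' * u = u * g := by
  ext a
  change g' (u a) = u (g a)
  refine h.cases_mem (P := fun a b => g' (u a) = u b) ?_ ?_ ?_ ?_ ?_ a
  · exact h'.fst
  · exact h'.snd
  · rw [hu, hu]; exact h'.neg_fst
  · rw [hu, hu]; exact h'.neg_snd
  · intro a h1 h2 h3 h4
    exact h'.fix _ (fun e => h1 (u.injective e)) (fun e => h2 (u.injective e))
      (fun e => h3 (u.injective (by rw [hu]; exact e)))
      (fun e => h4 (u.injective (by rw [hu]; exact e)))

end IsReflection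

/-- Data of a reflection arrangement inside the hyperoctahedral arrangement. -/
structure SignedData [Finite Ω] (neg : Ω → Ω) (Φ : Ω → Ω → Prop) (s : ℕ → Equiv.Perm Ω) (r : ℕ)
    (root : ℕ → Ω × Ω) (pt : Finset ℕ → Ω → ℤ) : Prop where
  neg_neg : Function.Involutive neg
  symm : ∀ a b, Φ a b → Φ b a
  neg_swap : ∀ a b, Φ a b → Φ (neg b) (neg a)
  root_mem : ∀ i < r, Φ (root i).1 (root i).2
  refl : ∀ i < r, IsReflection neg (s i) (root i)
  gen_mem : ∀ i < r, ∀ a b, Φ a b → Φ (s i a) (s i b)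
  total : ∀ P : Ω → Ω → Prop, (∀ a, P a a) → (∀ a b c, P a b → P b c → P a c) →
    (∀ a b, P a b → P (neg b) (neg a)) → (∀ i < r, P (root i).1 (root i).2) →
    ∀ a b, Φ a b → P a b ∨ P b a
  pt_neg : ∀ J c, pt J (neg c) = -pt J c
  pt_root : ∀ J, ∀ i < r, if i ∈ J then pt J (root i).1 = pt J (root i).2
    else pt J (root i).2 < pt J (root i).1
  pt_inj : ∀ a b, Φ a b → pt ∅ a = pt ∅ b → a = b
  sign_change : ∀ i < r, ∀ c : Ω × Ω, Φ c.1 c.2 → pt ∅ c.2 < pt ∅ c.1 →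
    pt ∅ (s i c.1) < pt ∅ (s i c.2) → c = root i ∨ c = dualPair neg (root i)

lemma signVec_swap (symm : ∀ a b, Φ a b → Φ b a) (y : Ω → ℤ) (a b : Ω) :
    signVec Φ y (b, a) = -signVec Φ y (a, b) := by
  rw [signVec_apply, signVec_apply]
  by_cases h : Φ a b
  · rw [if_pos h, if_pos (symm _ _ h), ← Left.sign_neg, neg_sub]
  · rw [if_neg h, if_neg (fun h' => h (symm _ _ h'))]
    rfl

lemma signVec_eq_one {y : Ω → ℤ} {c : Ω × Ω} :
    signVec Φ y c = 1 ↔ Φ c.1 c.2 ∧ y c.2 < y c.1 := by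
  change (if Φ c.1 c.2 then SignType.sign (y c.1 - y c.2) else 0) = 1 ↔ _
  split_ifs with h
  · simp [h, sign_eq_one_iff]
  · simp [h]

lemma signVec_eq_neg_one {y : Ω → ℤ} {c : Ω × Ω} :
    signVec Φ y c = -1 ↔ Φ c.1 c.2 ∧ y c.1 < y c.2 := by
  change (if Φ c.1 c.2 then SignType.sign (y c.1 - y c.2) else 0) = -1 ↔ _
  split_ifs with h
  · simp [h, sign_eq_neg_one_iff]
  · simp [h]

lemma signVec_eq_zero {y : Ω → ℤ} {c : Ω × Ω} :
    signVec Φ y c = 0 ↔ (Φ c.1 c.2 → y c.1 = y c.2) := by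
  change (if Φ c.1 c.2 then SignType.sign (y c.1 - y c.2) else 0) = 0 ↔ _
  split_ifs with h
  · simp [h, sign_eq_zero_iff, sub_eq_zero]
  · simp [h]

lemma act_signVec {g : Equiv.Perm Ω} (hg : ∀ a b, Φ (g⁻¹ a) (g⁻¹ b) ↔ Φ a b) (y : Ω → ℤ) :
    act g (signVec Φ y) = signVec Φ fun c => y (g⁻¹ c) := by
  ext ⟨a, b⟩
  change (if Φ (g⁻¹ a) (g⁻¹ b) then _ else _) = if Φ a b then _ else _
  simp only [hg a b]
  rfl

namespace SignedData

variable [Finite Ω] {s : ℕ → Equiv.Perm Ω} {r : ℕ} {root : ℕ → Ω × Ω} {pt : Finset ℕ → Ω → ℤ}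

lemma gen_mem_iff (D : SignedData neg Φ s r root pt) {i : ℕ} (hi : i < r) (a b : Ω) :
    Φ (s i a) (s i b) ↔ Φ a b := by
  refine ⟨fun h => ?_, D.gen_mem i hi a b⟩
  have h' := D.gen_mem i hi _ _ h
  rwa [← Equiv.Perm.mul_apply, ← Equiv.Perm.mul_apply, (D.refl i hi).mul_self] at h'

lemma gen_inv (D : SignedData neg Φ s r root pt) {i : ℕ} (hi : i < r) : (s i)⁻¹ = s i :=
  inv_eq_of_mul_eq_one_left (D.refl i hi).mul_self

lemma map_neg_and_mem_iff (D : SignedData neg Φ s r root pt) {u : Equiv.Perm Ω}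
    (hu : u ∈ genSubgroup s (Set.Iio r)) :
    (∀ a, u (neg a) = neg (u a)) ∧ ∀ a b, Φ (u a) (u b) ↔ Φ a b := by
  obtain ⟨l, hl, rfl⟩ := exists_word (fun i hi => (D.refl i hi).mul_self) hu
  clear hu
  induction l with
  | nil => exact ⟨fun a => rfl, fun a b => Iff.rfl⟩
  | cons i t ih =>
    have hi : i < r := hl i (by simp)
    have ih := ih fun j hj => hl j (by simp [hj])
    rw [List.map_cons, List.prod_cons]
    refine ⟨fun a => ?_, fun a b => ?_⟩
    · rw [Equiv.Perm.mul_apply, Equiv.Perm.mul_apply, ih.1, (D.refl i hi).map_neg D.neg_neg]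
    · rw [Equiv.Perm.mul_apply, Equiv.Perm.mul_apply, D.gen_mem_iff hi, ih.2]

lemma act_signVec_gen (D : SignedData neg Φ s r root pt) {u : Equiv.Perm Ω}
    (hu : u ∈ genSubgroup s (Set.Iio r)) (y : Ω → ℤ) :
    act u (signVec Φ y) = signVec Φ fun c => y (u⁻¹ c) :=
  act_signVec (D.map_neg_and_mem_iff (inv_mem hu)).2 y

lemma signVec_congr (D : SignedData neg Φ s r root pt) {y z : Ω → ℤ}
    (hy : ∀ c, y (neg c) = -y c) (hz : ∀ c, z (neg c) = -z c)
    (h : ∀ i < r, y (root i).2 ≤ y (root i).1 ∧ z (root i).2 ≤ z (root i).1 ∧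
      (y (root i).1 = y (root i).2 ↔ z (root i).1 = z (root i).2)) :
    signVec Φ y = signVec Φ z := by
  ext ⟨a, b⟩
  rw [signVec_apply, signVec_apply]
  by_cases hab : Φ a b
  · rw [if_pos hab, if_pos hab]
    rcases D.total (fun a b => y b ≤ y a ∧ z b ≤ z a ∧ (y a = y b ↔ z a = z b)) (by simp)
      (fun a b c h1 h2 => by omega) (fun a b h1 => by simp only [hy, hz]; omega) h a b hab
      with h1 | h1
    · rcases h1.1.eq_or_lt with h2 | h2
      · rw [h2, h1.2.2.1 h2.symm, sub_self, sub_self]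
      · rw [sign_pos (by omega), sign_pos (by omega)]
    · rcases h1.1.eq_or_lt with h2 | h2
      · rw [h2, h1.2.2.1 h2.symm, sub_self, sub_self]
      · rw [sign_neg (by omega), sign_neg (by omega)]
  · rw [if_neg hab, if_neg hab]

lemma arrangement (D : SignedData neg Φ s r root pt) :
    Arrangement s r root (pointFaces neg Φ) fun J => signVec Φ (pt J) where
  sq i hi := (D.refl i hi).mul_self
  act_gen_mem i hi F hF := by
    obtain ⟨y, hy, rfl⟩ := hF
    refine ⟨_, fun c => ?_, D.act_signVec_gen (gen_mem_genSubgroup hi) y⟩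
    rw [D.gen_inv hi, (D.refl i hi).map_neg D.neg_neg, hy]
  face_mem J := ⟨_, D.pt_neg J, rfl⟩
  face_root J i hi := by
    have h := D.pt_root J i hi
    split_ifs at h ⊢ with hJ
    · exact signVec_eq_zero.2 fun _ => h
    · exact signVec_eq_one.2 ⟨D.root_mem i hi, h⟩
  eq_face F hF h := by
    obtain ⟨y, hy, rfl⟩ := hF
    refine D.signVec_congr hy (D.pt_neg _) fun i hi => ?_
    have h1 := D.pt_root ((Finset.range r).filter fun i => signVec Φ y (root i) = 0) i hi
    have h2 := h i hi
    have hm := D.root_mem i hi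
    simp only [Finset.mem_filter, Finset.mem_range, hi, true_and, signVec_eq_zero, hm,
      true_imp_iff] at h1
    rw [Ne, signVec_eq_neg_one, and_iff_right hm] at h2
    simp only [signVec_eq_zero]
    generalize pt _ (root i).1 = u at *
    generalize pt _ (root i).2 = v at *
    split_ifs at h1 <;> omega
  neg_root i hi F hF := by
    obtain ⟨y, hy, rfl⟩ := hF
    have : s i • root i = ((root i).2, (root i).1) :=
      Prod.ext (D.refl i hi).fst (D.refl i hi).snd
    rw [this, signVec_swap D.symm]
  simple i hi β h1 h2 F hF := by
    obtain ⟨y, hy, rfl⟩ := hF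
    rw [signVec_eq_one] at h1
    rw [signVec_eq_neg_one] at h2
    rcases D.sign_change i hi β h1.1 h1.2 h2.2 with rfl | rfl
    · rfl
    · have hm := D.root_mem i hi
      change (if Φ (neg (root i).2) (neg (root i).1) then _ else _) = if Φ _ _ then _ else _
      rw [if_pos (D.neg_swap _ _ hm), if_pos hm]
      congr 1
      simp only [dualPair, hy]
      ring
  conj u hu i hi j hj h1 h2 := by
    rw [signVec_eq_one] at h1
    rw [signVec_eq_neg_one] at h2
    refine (D.refl j hj).conj (D.map_neg_and_mem_iff hu).1 ?_
    rcases D.sign_change i hi _ h1.1 h1.2 h2.2 with h | h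
    · rw [h]; exact D.refl i hi
    · rw [h]; exact (D.refl i hi).dual D.neg_neg
  fix i hi F hF h := by
    obtain ⟨y, hy, rfl⟩ := hF
    rw [signVec_eq_zero] at h
    rw [D.act_signVec_gen (gen_mem_genSubgroup hi)]
    congr 1
    ext c
    rw [D.gen_inv hi, (D.refl i hi).map_eq_of_eq hy (h (D.root_mem i hi))]
  ne_zero_gen i hi β h h' := by
    refine h (signVec_eq_zero.2 fun hβ => ?_)
    have h1 := signVec_eq_zero.1 h' (D.gen_mem i hi _ _ hβ)
    have h2 := D.pt_inj _ _ (D.gen_mem i hi _ _ hβ) h1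
    rw [(s i).injective h2]
  exists_neg := by
    refine ⟨signVec Φ fun c => -pt ∅ c, ⟨_, fun c => by rw [D.pt_neg], rfl⟩, fun i hi => ?_⟩
    have h := D.pt_root ∅ i hi
    rw [if_neg (Finset.notMem_empty i)] at h
    exact signVec_eq_neg_one.2 ⟨D.root_mem i hi, neg_lt_neg h⟩

end SignedData

end Signed

/-! ### Restriction to a flat -/

section Restrict

variable {Γ ι Γ' ι' : Type*} [Group Γ] [MulAction Γ ι] [Group Γ'] [MulAction Γ' ι']

/-- Pull-back of sign vectors along an index map. -/
def pull (π : ι' → ι) : SignVec ι →* SignVec ι' where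
  toFun F := fun c => F (π c)
  map_one' := rfl
  map_mul' _ _ := rfl

lemma pull_apply (π : ι' → ι) (F : SignVec ι) (c : ι') : pull π F c = F (π c) := rfl

/-- Restriction of sign vectors along an index map, killing the sign vectors which do not vanish
on `R`. -/
noncomputable def restrictHom (R : Set ι) (π : ι' → ι) :
    SignVec ι →* MonoidAlgebra ℚ (SignVec ι') where
  toFun F := if ∀ c ∈ R, F c = 0 then MonoidAlgebra.single (pull π F) 1 else 0
  map_one' := if_pos fun _ _ => rfl
  map_mul' F G := by
    have h : (∀ c ∈ R, (F * G) c = 0) ↔ (∀ c ∈ R, F c = 0) ∧ ∀ c ∈ R, G c = 0 := by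
      rw [← forall₂_and]
      refine forall₂_congr fun c _ => ?_
      rw [SignVec.mul_apply]
      split_ifs with h <;> simp [h]
    simp only [h]
    by_cases hF : ∀ c ∈ R, F c = 0
    · by_cases hG : ∀ c ∈ R, G c = 0
      · rw [if_pos ⟨hF, hG⟩, if_pos hF, if_pos hG, MonoidAlgebra.single_mul_single, one_mul, map_mul]
      · rw [if_neg fun h => hG h.2, if_neg hG, mul_zero]
    · rw [if_neg fun h => hF h.1, if_neg hF, zero_mul]

/-- The linear extension of `restrictHom`. -/
noncomputable def restrictAlgHom (R : Set ι) (π : ι' → ι) :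
    MonoidAlgebra ℚ (SignVec ι) →ₐ[ℚ] MonoidAlgebra ℚ (SignVec ι') :=
  MonoidAlgebra.lift ℚ (MonoidAlgebra ℚ (SignVec ι')) (SignVec ι) (restrictHom R π)

variable {R : Set ι} {π : ι' → ι}

lemma restrictAlgHom_single (F : SignVec ι) (c : ℚ) :
    restrictAlgHom R π (MonoidAlgebra.single F c) =
      if ∀ c ∈ R, F c = 0 then MonoidAlgebra.single (pull π F) c else 0 := by
  rw [restrictAlgHom, MonoidAlgebra.lift_single]
  change c • (if ∀ c ∈ R, F c = 0 then MonoidAlgebra.single (pull π F) 1 else 0) = _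
  rw [smul_ite, smul_zero, MonoidAlgebra.smul_single, smul_eq_mul, mul_one]

variable {s : ℕ → Γ} {r : ℕ} {faces : Submonoid (SignVec ι)} {s' : ℕ → Γ'} {r' : ℕ}
  {faces' : Submonoid (SignVec ι')}

lemma induction_invAlg {a : MonoidAlgebra ℚ (SignVec ι)} (ha : a ∈ invAlg s r faces)
    {P : MonoidAlgebra ℚ (SignVec ι) → Prop} (h0 : P 0) (hadd : ∀ a b, P a → P b → P (a + b))
    (hs : ∀ F ∈ faces, ∀ c, P (MonoidAlgebra.single F c)) : P a := by
  obtain ⟨⟨b, rfl⟩, -⟩ := ha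
  induction b using MonoidAlgebra.induction_linear with
  | zero => simpa using h0
  | add f g hf hg => rw [map_add]; exact hadd _ _ hf hg
  | single F c =>
    change P (MonoidAlgebra.mapDomainAlgHom ℚ ℚ _ _)
    rw [mapDomainAlgHom_apply_single]
    exact hs _ F.2 c

lemma restrictAlgHom_mem_invAlg
    (hface : ∀ F ∈ faces, (∀ c ∈ R, F c = 0) → pull π F ∈ faces')
    (hact : ∀ g' ∈ genSubgroup s' (Set.Iio r'), ∃ g ∈ genSubgroup s (Set.Iio r), ∀ F ∈ faces,
      ((∀ c ∈ R, act g F c = 0) ↔ ∀ c ∈ R, F c = 0) ∧ ((∀ c ∈ R, F c = 0) →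
        pull π (act g F) = act g' (pull π F)))
    {a : MonoidAlgebra ℚ (SignVec ι)} (ha : a ∈ invAlg s r faces) :
    restrictAlgHom R π a ∈ invAlg s' r' faces' := by
  refine ⟨?_, fun g' hg' => ?_⟩
  · refine induction_invAlg ha (P := fun a => restrictAlgHom R π a ∈
      (MonoidAlgebra.mapDomainAlgHom ℚ ℚ faces'.subtype).range) (by rw [map_zero]; exact zero_mem _)
      (fun a b ha hb => by rw [map_add]; exact add_mem ha hb) fun F hF c => ?_
    rw [restrictAlgHom_single]
    split_ifs with h
    · exact ⟨MonoidAlgebra.single ⟨_, hface F hF h⟩ c, mapDomainAlgHom_apply_single _ _ _⟩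
    · exact zero_mem _
  · obtain ⟨g, hg, h⟩ := hact g' hg'
    conv_rhs => rw [← ha.2 g hg]
    refine induction_invAlg ha (P := fun a => MonoidAlgebra.mapDomainAlgHom ℚ ℚ (act g')
      (restrictAlgHom R π a) = restrictAlgHom R π (MonoidAlgebra.mapDomainAlgHom ℚ ℚ (act g) a))
      (by simp only [map_zero])
      (fun a b ha hb => by simp only [map_add, ha, hb]) fun F hF c => ?_
    rw [restrictAlgHom_single, mapDomainAlgHom_apply_single, restrictAlgHom_single]
    by_cases hR : ∀ c ∈ R, F c = 0
    · rw [if_pos hR, if_pos ((h F hF).1.2 hR), mapDomainAlgHom_apply_single, (h F hF).2 hR]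
    · rw [if_neg hR, if_neg (fun h' => hR ((h F hF).1.1 h')), map_zero]

lemma coeff_restrictAlgHom {a : MonoidAlgebra ℚ (SignVec ι)} (ha : a ∈ invAlg s r faces)
    {G : SignVec ι'} {F₀ : SignVec ι}
    (h : ∀ F ∈ faces, ((∀ c ∈ R, F c = 0) ∧ pull π F = G) ↔ F = F₀) :
    (restrictAlgHom R π a).coeff G = a.coeff F₀ := by
  refine induction_invAlg ha (P := fun a => (restrictAlgHom R π a).coeff G = a.coeff F₀)
    (by rw [map_zero]; rfl) (fun a b ha hb => ?_) fun F hF c => ?_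
  · rw [map_add, MonoidAlgebra.coeff_add, MonoidAlgebra.coeff_add, Finsupp.add_apply,
      Finsupp.add_apply, ha, hb]
  · rw [restrictAlgHom_single, MonoidAlgebra.coeff_single, Finsupp.single_apply, ← h F hF]
    by_cases hR : ∀ c ∈ R, F c = 0
    · rw [if_pos hR, MonoidAlgebra.coeff_single, Finsupp.single_apply]
      by_cases hG : pull π F = G
      · rw [if_pos hG, if_pos ⟨hR, hG⟩]
      · rw [if_neg hG, if_neg fun h' => hG h'.2]
    · rw [if_neg hR, if_neg (fun h' => hR h'.1)]
      rfl

end Restrict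

/-! ### Restriction of signed arrangements -/

section SignedRestrict

variable {Ω Ω' : Type*} {neg : Ω → Ω} {Φ : Ω → Ω → Prop} {neg' : Ω' → Ω'} {Φ' : Ω' → Ω' → Prop}

/-- The arrangement of `Φ'` is the restriction of the arrangement of `Φ` to the flat where the
coordinates `z` and `z'` vanish. -/
structure IsFlat (neg : Ω → Ω) (Φ : Ω → Ω → Prop) (neg' : Ω' → Ω') (Φ' : Ω' → Ω' → Prop)
    (emb : Ω' → Ω) (z z' : Ω) : Prop where
  map_neg : ∀ a, emb (neg' a) = neg (emb a)
  cover : ∀ c, (∃ a, c = emb a) ∨ c = z ∨ c = neg z ∨ c = z' ∨ c = neg z'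
  not_mem_neg : ∀ c, ¬ Φ c (neg c)
  mem_root : Φ z' z
  mem_root_neg : Φ z' (neg z)
  mem_emb : ∀ a b, b ≠ neg' a → (Φ' a b ↔ Φ (emb a) (emb b))
  mem_neg : ∀ a, Φ' a (neg' a) ↔ Φ (emb a) z
  mem_of_mem : ∀ a c, c = z ∨ c = neg z ∨ c = z' ∨ c = neg z' → Φ (emb a) c → Φ (emb a) z

/-- The roots vanishing on the flat where the coordinates `z` and `z'` vanish. -/
def flatRoots (neg : Ω → Ω) (z z' : Ω) : Set (Ω × Ω) := {(z', z), (z', neg z)}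

/-- A root of the ambient arrangement restricting to a given root. -/
noncomputable def flatIndex (neg' : Ω' → Ω') (emb : Ω' → Ω) (z : Ω) (c : Ω' × Ω') : Ω × Ω :=
  if c.2 = neg' c.1 then (emb c.1, z) else (emb c.1, emb c.2)

namespace IsFlat

variable {emb : Ω' → Ω} {z z' : Ω}

lemma forall_flatRoots_iff (E : IsFlat neg Φ neg' Φ' emb z z') {y : Ω → ℤ}
    (hy : ∀ c, y (neg c) = -y c) :
    (∀ c ∈ flatRoots neg z z', signVec Φ y c = 0) ↔ y z = 0 ∧ y z' = 0 := by
  have h1 := E.mem_root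
  have h2 := E.mem_root_neg
  simp only [flatRoots, Set.mem_insert_iff, Set.mem_singleton_iff, forall_eq_or_imp, forall_eq,
    signVec_eq_zero, h1, h2, true_imp_iff, hy]
  omega

lemma pull_signVec (E : IsFlat neg Φ neg' Φ' emb z z') {y : Ω → ℤ}
    (hy : ∀ c, y (neg c) = -y c) (hz : y z = 0) :
    pull (flatIndex neg' emb z) (signVec Φ y) = signVec Φ' fun a => y (emb a) := by
  ext ⟨a, b⟩
  rw [pull_apply, flatIndex, signVec_apply]
  by_cases h : b = neg' a
  · subst h
    rw [if_pos rfl, signVec_apply]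
    refine ite_congr (propext (E.mem_neg a).symm) (fun _ => ?_) fun _ => rfl
    change SignType.sign (y (emb a) - y z) = SignType.sign (y (emb a) - y (emb (neg' a)))
    rw [E.map_neg, hy, hz]
    rcases lt_trichotomy (y (emb a)) 0 with h | h | h
    · rw [sign_neg (by omega), sign_neg (by omega)]
    · simp [h]
    · rw [sign_pos (by omega), sign_pos (by omega)]
  · rw [if_neg h, signVec_apply]
    exact ite_congr (propext (E.mem_emb a b h).symm) (fun _ => rfl) fun _ => rfl

lemma signVec_eq_of_pull_eq (E : IsFlat neg Φ neg' Φ' emb z z') (symm : ∀ a b, Φ a b → Φ b a)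
    {x y : Ω → ℤ}
    (hx : ∀ c, x (neg c) = -x c) (hy : ∀ c, y (neg c) = -y c) (hxz : x z = 0 ∧ x z' = 0)
    (hyz : y z = 0 ∧ y z' = 0)
    (h : pull (flatIndex neg' emb z) (signVec Φ x) = pull (flatIndex neg' emb z) (signVec Φ y)) :
    signVec Φ x = signVec Φ y := by
  have hzero : ∀ w : Ω → ℤ, (∀ c, w (neg c) = -w c) → w z = 0 ∧ w z' = 0 → ∀ c,
      c = z ∨ c = neg z ∨ c = z' ∨ c = neg z' → w c = 0 := by
    rintro w hw ⟨h1, h2⟩ c (rfl | rfl | rfl | rfl) <;> simp [hw, h1, h2]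
  have hemb : ∀ a b, signVec Φ x (emb a, emb b) = signVec Φ y (emb a, emb b) := by
    intro a b
    by_cases hab : b = neg' a
    · rw [hab, E.map_neg, signVec_apply, signVec_apply, if_neg (E.not_mem_neg _),
        if_neg (E.not_mem_neg _)]
    · have := congr_fun h (a, b)
      rwa [pull_apply, pull_apply, flatIndex, if_neg hab] at this
  have hside : ∀ a c, c = z ∨ c = neg z ∨ c = z' ∨ c = neg z' →
      signVec Φ x (emb a, c) = signVec Φ y (emb a, c) := by
    intro a c hc
    rw [signVec_apply, signVec_apply]
    by_cases hm : Φ (emb a) c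
    · have := congr_fun h (a, neg' a)
      rw [pull_apply, pull_apply, flatIndex, if_pos rfl, signVec_apply, signVec_apply,
        if_pos (E.mem_of_mem a c hc hm), if_pos (E.mem_of_mem a c hc hm), hxz.1, hyz.1] at this
      rw [if_pos hm, if_pos hm, hzero x hx hxz c hc, hzero y hy hyz c hc, this]
    · rw [if_neg hm, if_neg hm]
  ext ⟨a, b⟩
  rcases E.cover a with ⟨a, rfl⟩ | ha
  · rcases E.cover b with ⟨b, rfl⟩ | hb
    · exact hemb a b
    · exact hside a b hb
  · rcases E.cover b with ⟨b, rfl⟩ | hb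
    · rw [signVec_swap symm, signVec_swap symm _ (emb b), hside b a ha]
    · rw [signVec_apply, signVec_apply, hzero x hx hxz a ha, hzero x hx hxz b hb,
        hzero y hy hyz a ha, hzero y hy hyz b hb]

variable [Finite Ω] {s : ℕ → Equiv.Perm Ω} {r : ℕ} {root : ℕ → Ω × Ω}
  {pt : Finset ℕ → Ω → ℤ} {s' : ℕ → Equiv.Perm Ω'} {r' : ℕ} {root' : ℕ → Ω' × Ω'}
  {pt' : Finset ℕ → Ω' → ℤ}

lemma exists_lift [Finite Ω'] (D : SignedData neg Φ s r root pt) (D' : SignedData neg' Φ' s' r' root' pt')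
    (hgen : ∀ i < r', ∃ g ∈ genSubgroup s (Set.Iio r), (∀ a, g (emb a) = emb (s' i a)) ∧
      (g z = z ∨ g z = neg z) ∧ g z' = z')
    {u : Equiv.Perm Ω'} (hu : u ∈ genSubgroup s' (Set.Iio r')) :
    ∃ g ∈ genSubgroup s (Set.Iio r), (∀ a, g (emb a) = emb (u a)) ∧
      (g z = z ∨ g z = neg z) ∧ g z' = z' := by
  obtain ⟨l, hl, rfl⟩ := exists_word (fun i hi => (D'.refl i hi).mul_self) hu
  clear hu
  induction l with
  | nil => exact ⟨1, one_mem _, fun a => rfl, Or.inl rfl, rfl⟩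
  | cons i t ih =>
    obtain ⟨g, hg, h1, h2, h3⟩ := hgen i (hl i (by simp))
    obtain ⟨k, hk, h1', h2', h3'⟩ := ih fun j hj => hl j (by simp [hj])
    refine ⟨g * k, mul_mem hg hk, fun a => ?_, ?_, ?_⟩
    · rw [Equiv.Perm.mul_apply, h1', h1, List.map_cons, List.prod_cons, Equiv.Perm.mul_apply]
    · rw [Equiv.Perm.mul_apply]
      rcases h2' with h2' | h2'
      · rwa [h2']
      · rw [h2', (D.map_neg_and_mem_iff hg).1]
        rcases h2 with h2 | h2
        · exact Or.inr (by rw [h2])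
        · exact Or.inl (by rw [h2, D.neg_neg])
    · rw [Equiv.Perm.mul_apply, h3', h3]

lemma map_mem_invAlg [Finite Ω'] (E : IsFlat neg Φ neg' Φ' emb z z') (D : SignedData neg Φ s r root pt)
    (D' : SignedData neg' Φ' s' r' root' pt')
    (hgen : ∀ i < r', ∃ g ∈ genSubgroup s (Set.Iio r), (∀ a, g (emb a) = emb (s' i a)) ∧
      (g z = z ∨ g z = neg z) ∧ g z' = z')
    {a : MonoidAlgebra ℚ (SignVec (Ω × Ω))} (ha : a ∈ invAlg s r (pointFaces neg Φ)) :
    restrictAlgHom (flatRoots neg z z') (flatIndex neg' emb z) a ∈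
      invAlg s' r' (pointFaces neg' Φ') := by
  refine restrictAlgHom_mem_invAlg ?_ (fun u hu => ?_) ha
  · rintro F ⟨y, hy, rfl⟩ h
    rw [E.forall_flatRoots_iff hy] at h
    exact ⟨_, fun c => by rw [E.map_neg, hy], E.pull_signVec hy h.1⟩
  · obtain ⟨g, hg, h1, h2, h3⟩ := exists_lift D D' hgen hu
    refine ⟨g, hg, ?_⟩
    rintro F ⟨y, hy, rfl⟩
    have hn := (D.map_neg_and_mem_iff (inv_mem hg)).1
    have hy' : ∀ c, y (g⁻¹ (neg c)) = -y (g⁻¹ c) := fun c => by rw [hn, hy]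
    have hz : y (g⁻¹ z) = 0 ↔ y z = 0 := by
      rcases h2 with h2 | h2
      · rw [Equiv.Perm.inv_eq_iff_eq.2 h2.symm]
      · rw [← neg_eq_zero, ← hy', ← h2, Equiv.Perm.coe_inv, Equiv.symm_apply_apply]
    have hz' : g⁻¹ z' = z' := Equiv.Perm.inv_eq_iff_eq.2 h3.symm
    rw [D.act_signVec_gen hg, E.forall_flatRoots_iff hy, E.forall_flatRoots_iff hy', hz, hz']
    refine ⟨Iff.rfl, fun h => ?_⟩
    rw [E.pull_signVec hy' (hz.2 h.1), E.pull_signVec hy h.1, D'.act_signVec_gen hu]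
    congr 1
    ext a
    congr 1
    rw [Equiv.Perm.inv_eq_iff_eq, h1, Equiv.Perm.coe_inv, Equiv.apply_symm_apply]

lemma coeff_map (E : IsFlat neg Φ neg' Φ' emb z z') (D : SignedData neg Φ s r root pt)
    {a : MonoidAlgebra ℚ (SignVec (Ω × Ω))} (ha : a ∈ invAlg s r (pointFaces neg Φ))
    {J K : Finset ℕ} (hJ : pt J z = 0 ∧ pt J z' = 0) (hJK : ∀ a, pt J (emb a) = pt' K a) :
    (restrictAlgHom (flatRoots neg z z') (flatIndex neg' emb z) a).coeff (signVec Φ' (pt' K)) =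
      a.coeff (signVec Φ (pt J)) := by
  have hK : signVec Φ' (pt' K) = pull (flatIndex neg' emb z) (signVec Φ (pt J)) := by
    rw [E.pull_signVec (D.pt_neg J) hJ.1]
    simp only [hJK]
  refine coeff_restrictAlgHom ha ?_
  rintro F ⟨y, hy, rfl⟩
  rw [E.forall_flatRoots_iff hy, hK]
  refine ⟨fun h => E.signVec_eq_of_pull_eq D.symm hy (D.pt_neg J) h.1 hJ h.2, fun h => ?_⟩
  rw [h]
  rw [← E.forall_flatRoots_iff hy, h, E.forall_flatRoots_iff (D.pt_neg J)]
  exact ⟨hJ, rfl⟩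

end IsFlat

end SignedRestrict

/-! ### Signed points -/

section Points

variable {n : ℕ}

/-- The point of `Dom n` of index `k` and sign `b`. -/
def dom (n k : ℕ) (b : Bool) : Dom n := (Fin.ofNat (n + 1) k, b)

/-- The opposite point. -/
def negD (c : Dom n) : Dom n := (c.1, !c.2)

/-- The nonzero integer encoded by a point. -/
def code (c : Dom n) : ℤ := if c.2 then (c.1 : ℤ) + 1 else -((c.1 : ℤ) + 1)

lemma code_true (k : Fin (n + 1)) : code (k, true) = (k : ℤ) + 1 := rfl

lemma code_false (k : Fin (n + 1)) : code (k, false) = -((k : ℤ) + 1) := rfl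

lemma code_negD (c : Dom n) : code (negD c) = -code c := by
  rcases c with ⟨k, b | b⟩
  · simp [negD, code]
  · simp [negD, code]

lemma negD_negD : Function.Involutive (negD (n := n)) := by
  rintro ⟨k, b⟩
  simp [negD]

lemma natAbs_code (c : Dom n) : (code c).natAbs = c.1 + 1 := by
  rcases c with ⟨k, b | b⟩
  · rw [code_false]
    change _ = (k : ℕ) + 1
    omega
  · rw [code_true]
    change _ = (k : ℕ) + 1
    omega

lemma code_ne_zero (c : Dom n) : code c ≠ 0 := by
  have := natAbs_code c
  omega

lemma code_injective : Function.Injective (code (n := n)) := by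
  rintro ⟨k, b | b⟩ ⟨l, b' | b'⟩ h
  all_goals
    simp only [code_true, code_false] at h
  · rw [show k = l by omega]
  · omega
  · omega
  · rw [show k = l by omega]

lemma code_dom {k : ℕ} (hk : k ≤ n) (b : Bool) :
    code (dom n k b) = if b then (k : ℤ) + 1 else -((k : ℤ) + 1) := by
  have : ((Fin.ofNat (n + 1) k : Fin (n + 1)) : ℕ) = k := Nat.mod_eq_of_lt (by omega)
  simp only [dom, code, this]

lemma dom_self (c : Dom n) : dom n c.1 c.2 = c := by
  simp [dom]

lemma pt_natCast_succ (k : ℕ) : pt n ((k : ℤ) + 1) = dom n k true := by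
  have h : ((k : ℤ) + 1).natAbs - 1 = k := by omega
  have h' : (0 : ℤ) < (k : ℤ) + 1 := by omega
  simp [pt, dom, h, h', Fin.ofNat]

lemma pt_neg_natCast_succ (k : ℕ) : pt n (-((k : ℤ) + 1)) = dom n k false := by
  have h : (-((k : ℤ) + 1)).natAbs - 1 = k := by omega
  have h' : ¬ (0 : ℤ) < -((k : ℤ) + 1) := by omega
  simp only [pt, dom, h, h', Fin.ofNat, decide_false]

lemma isReflection_swap_mul_swap {a b : Dom n} (h : code a ≠ -code b) :
    IsReflection negD (Equiv.swap (negD a) (negD b) * Equiv.swap b a) (a, b) := by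
  have ha := code_ne_zero a
  have hb := code_ne_zero b
  have hne : ∀ {x y : Dom n}, code x ≠ code y → x ≠ y := fun h e => h (by rw [e])
  have h1 : a ≠ negD a := hne (by rw [code_negD]; omega)
  have h2 : a ≠ negD b := hne (by rw [code_negD]; omega)
  have h3 : b ≠ negD a := hne (by rw [code_negD]; omega)
  have h4 : b ≠ negD b := hne (by rw [code_negD]; omega)
  constructor
  · rw [Equiv.Perm.mul_apply, Equiv.swap_apply_right, Equiv.swap_apply_of_ne_of_ne h3 h4]
  · rw [Equiv.Perm.mul_apply, Equiv.swap_apply_left, Equiv.swap_apply_of_ne_of_ne h1 h2]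
  · rw [Equiv.Perm.mul_apply, Equiv.swap_apply_of_ne_of_ne h3.symm h1.symm,
      Equiv.swap_apply_left]
  · rw [Equiv.Perm.mul_apply, Equiv.swap_apply_of_ne_of_ne h4.symm h2.symm,
      Equiv.swap_apply_right]
  · intro c e1 e2 e3 e4
    rw [Equiv.Perm.mul_apply, Equiv.swap_apply_of_ne_of_ne e2 e1,
      Equiv.swap_apply_of_ne_of_ne e3 e4]

lemma IsReflection.code_apply {g : Equiv.Perm (Dom n)} {c : Dom n × Dom n}
    (h : IsReflection negD g c) (a : Dom n) :
    code (g a) = if code a = code c.1 then code c.2 else if code a = code c.2 then code c.1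
      else if code a = -code c.1 then -code c.2 else if code a = -code c.2 then -code c.1
      else code a := by
  simp only [← code_negD, code_injective.eq_iff]
  split_ifs with h1 h2 h3 h4
  · rw [h1, h.fst]
  · rw [h2, h.snd]
  · rw [h3, h.neg_fst]
  · rw [h4, h.neg_snd]
  · rw [h.fix a h1 h2 h3 h4]

/-- The simple roots of type `D`. -/
def rootD (n i : ℕ) : Dom n × Dom n :=
  if i = 0 then (dom n 1 true, dom n 0 false) else (dom n i true, dom n (i - 1) true)

/-- The simple roots of type `B`. -/
def rootB (n i : ℕ) : Dom n × Dom n :=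
  if i = 0 then (dom n 0 true, dom n 0 false) else (dom n i true, dom n (i - 1) true)

lemma gen_succ (i : ℕ) : gen n (i + 1) = Equiv.swap (dom n (i + 1) false) (dom n i false) *
    Equiv.swap (dom n i true) (dom n (i + 1) true) := by
  rw [gen, if_neg i.succ_ne_zero, swapD, swapD, ← pt_natCast_succ, ← pt_natCast_succ,
    ← pt_neg_natCast_succ, ← pt_neg_natCast_succ]
  push_cast
  rw [show -((i : ℤ) + 1) - 1 = -((i : ℤ) + 1 + 1) by ring]

lemma genB_succ (i : ℕ) : genB n (i + 1) = gen n (i + 1) := by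
  rw [gen, genB, if_neg i.succ_ne_zero, if_neg i.succ_ne_zero]

lemma isReflection_gen_succ {i : ℕ} (hi : i + 1 < n) :
    IsReflection negD (gen n (i + 1)) (dom n (i + 1) true, dom n i true) := by
  rw [gen_succ]
  refine isReflection_swap_mul_swap ?_
  rw [code_dom (by omega), code_dom (by omega), if_pos rfl, if_pos rfl]
  omega

lemma isReflection_gen (hn : 2 ≤ n) {i : ℕ} (hi : i < n) :
    IsReflection negD (gen n i) (rootD n i) := by
  rcases i with _ | i
  · have h : gen n 0 = Equiv.swap (dom n 1 false) (dom n 0 true) *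
        Equiv.swap (dom n 0 false) (dom n 1 true) := by
      have e1 := pt_natCast_succ (n := n) 0
      have e2 := pt_natCast_succ (n := n) 1
      have e3 := pt_neg_natCast_succ (n := n) 0
      have e4 := pt_neg_natCast_succ (n := n) 1
      norm_num at e1 e2 e3 e4
      rw [gen, if_pos rfl, swapD, swapD, e1, e2, e3, e4]
    rw [h, rootD, if_pos rfl]
    refine isReflection_swap_mul_swap ?_
    rw [code_dom (by omega), code_dom (by omega), if_pos rfl, if_neg Bool.false_ne_true]
    omega
  · exact isReflection_gen_succ hi

lemma isReflection_genB {i : ℕ} (hi : i < n) : IsReflection negD (genB n i) (rootB n i) := by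
  rcases i with _ | i
  · have h : genB n 0 = Equiv.swap (dom n 0 false) (dom n 0 true) := by
      have e1 := pt_natCast_succ (n := n) 0
      have e3 := pt_neg_natCast_succ (n := n) 0
      norm_num at e1 e3
      rw [genB, if_pos rfl, swapD, e1, e3]
    rw [h, rootB, if_pos rfl]
    constructor
    · exact Equiv.swap_apply_right _ _
    · exact Equiv.swap_apply_left _ _
    · exact Equiv.swap_apply_left _ _
    · exact Equiv.swap_apply_right _ _
    · exact fun a h1 h2 _ _ => Equiv.swap_apply_of_ne_of_ne h2 h1
  · rw [genB_succ]
    exact isReflection_gen_succ hi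

/-- The pairs of points indexing the roots of type `B`. -/
def RootB (a b : Dom n) : Prop := (code a).natAbs ≤ n ∧ (code b).natAbs ≤ n ∧ code a ≠ code b

/-- The pairs of points indexing the roots of type `D`. -/
def RootD (a b : Dom n) : Prop := RootB a b ∧ code a ≠ -code b

/-- The odd function with the given values on the positive points. -/
def oddPt (p : ℕ → ℤ) (c : Dom n) : ℤ := if c.2 then p c.1 else -p c.1

lemma oddPt_negD (p : ℕ → ℤ) (c : Dom n) : oddPt p (negD c) = -oddPt p c := by
  rcases c with ⟨k, b | b⟩ <;> simp [negD, oddPt]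

lemma oddPt_dom (p : ℕ → ℤ) {k : ℕ} (hk : k ≤ n) (b : Bool) :
    oddPt p (dom n k b) = if b then p k else -p k := by
  have : ((Fin.ofNat (n + 1) k : Fin (n + 1)) : ℕ) = k := Nat.mod_eq_of_lt (by omega)
  simp only [dom, oddPt, this]

/-- The coordinates of a point in the interior of the face of type `B` indexed by `J`. -/
noncomputable def coordB (J : Finset ℕ) : ℕ → ℤ
  | 0 => if 0 ∈ J then 0 else 1
  | k + 1 => coordB J k + if k + 1 ∈ J then 0 else 1

/-- The coordinates of a point in the interior of the face of type `D` indexed by `J`. -/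
noncomputable def coordD (J : Finset ℕ) : ℕ → ℤ
  | 0 => (if 0 ∈ J then 0 else 1) - if 1 ∈ J then 0 else 1
  | 1 => (if 0 ∈ J then 0 else 1) + if 1 ∈ J then 0 else 1
  | k + 2 => coordD J (k + 1) + if k + 2 ∈ J then 0 else 1

lemma coordB_empty (k : ℕ) : coordB ∅ k = k + 1 := by
  induction k with
  | zero => simp [coordB]
  | succ k ih => simp [coordB, ih]

lemma coordD_empty (k : ℕ) : coordD ∅ k = if k = 0 then 0 else (k : ℤ) + 1 := by
  induction k with
  | zero => simp [coordD]
  | succ k ih =>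
    rcases k with _ | k
    · simp [coordD]
    · simp [coordD, ih]

lemma oddPt_coordB_empty (c : Dom n) : oddPt (coordB ∅) c = code c := by
  rcases c with ⟨k, b | b⟩ <;> simp [oddPt, code, coordB_empty]

lemma oddPt_coordD_empty (c : Dom n) :
    oddPt (coordD ∅) c = if (code c).natAbs = 1 then 0 else code c := by
  rw [natAbs_code]
  rcases c with ⟨k, b | b⟩ <;> by_cases hk : (k : ℕ) = 0 <;> simp [oddPt, code, coordD_empty, hk]

end Points

section Types

variable {n : ℕ}

lemma natAbs_code_gen_le {g : Equiv.Perm (Dom n)} {c : Dom n × Dom n} (h : IsReflection negD g c)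
    (h1 : (code c.1).natAbs ≤ n) (h2 : (code c.2).natAbs ≤ n) {a : Dom n}
    (ha : (code a).natAbs ≤ n) : (code (g a)).natAbs ≤ n := by
  rw [h.code_apply]
  split_ifs <;> omega

lemma rootD_mem (hn : 2 ≤ n) {i : ℕ} (hi : i < n) : RootD (rootD n i).1 (rootD n i).2 := by
  rcases i with _ | i
  · simp only [rootD, RootD, RootB, if_pos, code_dom (show 1 ≤ n by omega),
      code_dom (show 0 ≤ n by omega), Bool.false_eq_true, if_false]
    omega
  · simp only [rootD, RootD, RootB, if_neg i.succ_ne_zero, Nat.add_sub_cancel, if_pos,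
      code_dom (show i + 1 ≤ n by omega), code_dom (show i ≤ n by omega)]
    omega

lemma rootB_mem {i : ℕ} (hi : i < n) : RootB (rootB n i).1 (rootB n i).2 := by
  rcases i with _ | i
  · simp only [rootB, RootB, if_pos, code_dom (show 0 ≤ n by omega), Bool.false_eq_true,
      if_false]
    omega
  · simp only [rootB, RootB, if_neg i.succ_ne_zero, Nat.add_sub_cancel, if_pos,
      code_dom (show i + 1 ≤ n by omega), code_dom (show i ≤ n by omega)]
    omega

lemma eq_root_or_dual {c d : Dom n × Dom n} (h : code c.1 = code d.1 ∧ code c.2 = code d.2 ∨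
    code c.1 = -code d.2 ∧ code c.2 = -code d.1) : c = d ∨ c = dualPair negD d := by
  rcases h with h | h
  · exact Or.inl (Prod.ext (code_injective h.1) (code_injective h.2))
  · refine Or.inr (Prod.ext (code_injective ?_) (code_injective ?_))
    · rw [h.1]; exact (code_negD _).symm
    · rw [h.2]; exact (code_negD _).symm

lemma rel_dom_of_le {P : Dom n → Dom n → Prop} (hrefl : ∀ a, P a a)
    (htrans : ∀ a b c, P a b → P b c → P a c)
    (h : ∀ i, i + 1 < n → P (dom n (i + 1) true) (dom n i true)) {i j : ℕ} (hij : i ≤ j)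
    (hj : j < n) : P (dom n j true) (dom n i true) := by
  induction j, hij using Nat.le_induction with
  | base => exact hrefl _
  | succ j _ ih => exact htrans _ _ _ (h j hj) (ih (by omega))

lemma exists_dom_eq {a : Dom n} (ha : (code a).natAbs ≤ n) : ∃ i < n, ∃ b, a = dom n i b := by
  rw [natAbs_code] at ha
  exact ⟨a.1, ha, a.2, (dom_self a).symm⟩

lemma totalB {P : Dom n → Dom n → Prop} (hrefl : ∀ a, P a a)
    (htrans : ∀ a b c, P a b → P b c → P a c) (hneg : ∀ a b, P a b → P (negD b) (negD a))
    (h : ∀ i < n, P (rootB n i).1 (rootB n i).2) {a b : Dom n} (hab : RootB a b) :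
    P a b ∨ P b a := by
  obtain ⟨i, hi, x, rfl⟩ := exists_dom_eq hab.1
  obtain ⟨j, hj, y, rfl⟩ := exists_dom_eq hab.2.1
  have hle : ∀ {i j : ℕ}, i ≤ j → j < n → P (dom n j true) (dom n i true) :=
    rel_dom_of_le hrefl htrans fun i hi => h (i + 1) hi
  have hopp : ∀ {i j : ℕ}, i < n → j < n → P (dom n i true) (dom n j false) := fun hi hj =>
    htrans _ _ _ (hle (Nat.zero_le _) hi)
      (htrans _ _ _ (h 0 (by omega)) (hneg _ _ (hle (Nat.zero_le _) hj)))
  rcases x with _ | _ <;> rcases y with _ | _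
  · rcases le_total i j with hij | hij
    · exact Or.inl (hneg _ _ (hle hij hj))
    · exact Or.inr (hneg _ _ (hle hij hi))
  · exact Or.inr (hopp hj hi)
  · exact Or.inl (hopp hi hj)
  · rcases le_total i j with hij | hij
    · exact Or.inr (hle hij hj)
    · exact Or.inl (hle hij hi)

lemma totalD {P : Dom n → Dom n → Prop} (hrefl : ∀ a, P a a)
    (htrans : ∀ a b c, P a b → P b c → P a c) (hneg : ∀ a b, P a b → P (negD b) (negD a))
    (h : ∀ i < n, P (rootD n i).1 (rootD n i).2) {a b : Dom n} (hab : RootD a b) :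
    P a b ∨ P b a := by
  obtain ⟨⟨ha, hb, hne⟩, hne'⟩ := hab
  obtain ⟨i, hi, x, rfl⟩ := exists_dom_eq ha
  obtain ⟨j, hj, y, rfl⟩ := exists_dom_eq hb
  have hle : ∀ {i j : ℕ}, i ≤ j → j < n → P (dom n j true) (dom n i true) :=
    rel_dom_of_le hrefl htrans fun i hi => h (i + 1) hi
  have hopp : ∀ {i j : ℕ}, i < j → j < n → P (dom n j true) (dom n i false) := fun hij hj =>
    htrans _ _ _ (hle (show 1 ≤ _ by omega) hj)
      (htrans _ _ _ (h 0 (by omega)) (hneg _ _ (hle (Nat.zero_le _) (hij.trans hj))))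
  have hij : i ≠ j := by
    rintro rfl
    rw [code_dom hi.le, code_dom hi.le] at hne hne'
    rcases x with _ | _ <;> rcases y with _ | _ <;> simp at hne hne'
  rcases lt_or_gt_of_ne hij with hij | hij
  · rcases x with _ | _ <;> rcases y with _ | _
    · exact Or.inl (hneg _ _ (hle hij.le hj))
    · exact Or.inr (hopp hij hj)
    · exact Or.inl (hneg _ _ (hopp hij hj))
    · exact Or.inr (hle hij.le hj)
  · rcases x with _ | _ <;> rcases y with _ | _
    · exact Or.inr (hneg _ _ (hle hij.le hi))
    · exact Or.inr (hneg _ _ (hopp hij hi))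
    · exact Or.inl (hopp hij hi)
    · exact Or.inl (hle hij.le hi)

lemma signedDataB (n : ℕ) :
    SignedData negD RootB (genB n) n (rootB n) fun J => oddPt (coordB J) where
  neg_neg := negD_negD
  symm a b h := ⟨h.2.1, h.1, h.2.2.symm⟩
  neg_swap a b h := by
    simp only [RootB, code_negD] at h ⊢
    omega
  root_mem i hi := rootB_mem hi
  refl i hi := isReflection_genB hi
  gen_mem i hi a b h := by
    have hr := rootB_mem hi
    refine ⟨natAbs_code_gen_le (isReflection_genB hi) hr.1 hr.2.1 h.1,
      natAbs_code_gen_le (isReflection_genB hi) hr.1 hr.2.1 h.2.1, fun e => h.2.2 ?_⟩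
    rw [(genB n i).injective (code_injective e)]
  total P h1 h2 h3 h4 a b h := totalB h1 h2 h3 h4 h
  pt_neg J c := oddPt_negD _ c
  pt_root J i hi := by
    rcases i with _ | i
    · simp only [rootB, if_pos, oddPt_dom _ (Nat.zero_le n), Bool.false_eq_true, if_false, coordB]
      split_ifs <;> omega
    · simp only [rootB, if_neg i.succ_ne_zero, Nat.add_sub_cancel, if_pos, oddPt_dom _ hi.le,
        oddPt_dom _ (show i ≤ n by omega), coordB]
      split_ifs <;> omega
  pt_inj a b _ h := code_injective (by simpa only [oddPt_coordB_empty] using h)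
  sign_change i hi c hc h1 h2 := by
    refine eq_root_or_dual ?_
    simp only [oddPt_coordB_empty, (isReflection_genB hi).code_apply] at h1 h2
    have hc1 := code_ne_zero c.1
    have hc2 := code_ne_zero c.2
    rcases i with _ | i
    · simp only [rootB, if_pos, code_dom (Nat.zero_le n), Bool.false_eq_true, if_false] at h2 ⊢
      split_ifs at h2 <;> omega
    · simp only [rootB, if_neg i.succ_ne_zero, Nat.add_sub_cancel, if_pos, code_dom hi.le,
        code_dom (show i ≤ n by omega)] at h2 ⊢
      split_ifs at h2 <;> omega

lemma sign_change_zero {u v u' v' : ℤ} (hu : u ≠ 0) (hv : v ≠ 0) (h3 : u ≠ v) (h4 : u ≠ -v)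
    (h1 : (if v.natAbs = 1 then 0 else v) < if u.natAbs = 1 then 0 else u)
    (h2 : (if u'.natAbs = 1 then 0 else u') < if v'.natAbs = 1 then 0 else v')
    (hu' : u' = if u = ((1 : ℕ) : ℤ) + 1 then -(((0 : ℕ) : ℤ) + 1)
      else if u = -(((0 : ℕ) : ℤ) + 1) then ((1 : ℕ) : ℤ) + 1
      else if u = -(((1 : ℕ) : ℤ) + 1) then -(-(((0 : ℕ) : ℤ) + 1))
      else if u = -(-(((0 : ℕ) : ℤ) + 1)) then -(((1 : ℕ) : ℤ) + 1) else u)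
    (hv' : v' = if v = ((1 : ℕ) : ℤ) + 1 then -(((0 : ℕ) : ℤ) + 1)
      else if v = -(((0 : ℕ) : ℤ) + 1) then ((1 : ℕ) : ℤ) + 1
      else if v = -(((1 : ℕ) : ℤ) + 1) then -(-(((0 : ℕ) : ℤ) + 1))
      else if v = -(-(((0 : ℕ) : ℤ) + 1)) then -(((1 : ℕ) : ℤ) + 1) else v) :
    u = ((1 : ℕ) : ℤ) + 1 ∧ v = -(((0 : ℕ) : ℤ) + 1) ∨
      u = -(-(((0 : ℕ) : ℤ) + 1)) ∧ v = -(((1 : ℕ) : ℤ) + 1) := by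
  split_ifs at hu' <;> split_ifs at hv' <;> subst hu' hv' <;> split_ifs at h1 <;>
    split_ifs at h2 <;> omega

lemma sign_change_succ {i : ℕ} {u v u' v' : ℤ} (hu : u ≠ 0) (hv : v ≠ 0) (h3 : u ≠ v)
    (h4 : u ≠ -v)
    (h1 : (if v.natAbs = 1 then 0 else v) < if u.natAbs = 1 then 0 else u)
    (h2 : (if u'.natAbs = 1 then 0 else u') < if v'.natAbs = 1 then 0 else v')
    (hu' : u' = if u = ((i + 1 : ℕ) : ℤ) + 1 then (i : ℤ) + 1
      else if u = (i : ℤ) + 1 then ((i + 1 : ℕ) : ℤ) + 1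
      else if u = -(((i + 1 : ℕ) : ℤ) + 1) then -((i : ℤ) + 1)
      else if u = -((i : ℤ) + 1) then -(((i + 1 : ℕ) : ℤ) + 1) else u)
    (hv' : v' = if v = ((i + 1 : ℕ) : ℤ) + 1 then (i : ℤ) + 1
      else if v = (i : ℤ) + 1 then ((i + 1 : ℕ) : ℤ) + 1
      else if v = -(((i + 1 : ℕ) : ℤ) + 1) then -((i : ℤ) + 1)
      else if v = -((i : ℤ) + 1) then -(((i + 1 : ℕ) : ℤ) + 1) else v) :
    u = ((i + 1 : ℕ) : ℤ) + 1 ∧ v = (i : ℤ) + 1 ∨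
      u = -((i : ℤ) + 1) ∧ v = -(((i + 1 : ℕ) : ℤ) + 1) := by
  split_ifs at hu' <;> split_ifs at hv' <;> subst hu' hv' <;> split_ifs at h1 <;>
    split_ifs at h2 <;> omega

lemma signedDataD (hn : 2 ≤ n) :
    SignedData negD RootD (gen n) n (rootD n) fun J => oddPt (coordD J) where
  neg_neg := negD_negD
  symm a b h := by
    simp only [RootD, RootB] at h ⊢
    omega
  neg_swap a b h := by
    simp only [RootD, RootB, code_negD] at h ⊢
    omega
  root_mem i hi := rootD_mem hn hi
  refl i hi := isReflection_gen hn hi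
  gen_mem i hi a b h := by
    have hr := (rootD_mem hn hi).1
    have hg := isReflection_gen hn hi
    refine ⟨⟨natAbs_code_gen_le hg hr.1 hr.2.1 h.1.1, natAbs_code_gen_le hg hr.1 hr.2.1 h.1.2.1,
      fun e => h.1.2.2 ?_⟩, fun e => h.2 ?_⟩
    · rw [(gen n i).injective (code_injective e)]
    · rw [← code_negD, ← hg.map_neg negD_negD] at e
      rw [(gen n i).injective (code_injective e), code_negD]
  total P h1 h2 h3 h4 a b h := totalD h1 h2 h3 h4 h
  pt_neg J c := oddPt_negD _ c
  pt_root J i hi := by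
    rcases i with _ | _ | i
    · simp only [rootD, if_pos, oddPt_dom _ (Nat.zero_le n), oddPt_dom _ (show 1 ≤ n by omega),
        Bool.false_eq_true, if_false, coordD]
      split_ifs <;> omega
    · simp only [rootD, if_neg (Nat.succ_ne_zero _), if_pos, oddPt_dom _ hi.le,
        oddPt_dom _ (Nat.zero_le n), coordD, Nat.zero_add]
      split_ifs <;> omega
    · simp only [rootD, if_neg (Nat.succ_ne_zero _), Nat.add_sub_cancel, if_pos,
        oddPt_dom _ hi.le, oddPt_dom _ (show i + 1 ≤ n by omega), coordD]
      split_ifs <;> omega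
  pt_inj a b h h' := by
    refine code_injective ?_
    simp only [oddPt_coordD_empty] at h'
    obtain ⟨⟨-, -, h1⟩, h2⟩ := h
    have ha := code_ne_zero a
    have hb := code_ne_zero b
    split_ifs at h' <;> omega
  sign_change i hi c hc h1 h2 := by
    refine eq_root_or_dual ?_
    simp only [oddPt_coordD_empty] at h1 h2
    obtain ⟨⟨-, -, h3⟩, h4⟩ := hc
    have e1 := (isReflection_gen hn hi).code_apply c.1
    have e2 := (isReflection_gen hn hi).code_apply c.2
    rcases i with _ | i
    · simp only [rootD, if_pos, code_dom (Nat.zero_le n), code_dom (show 1 ≤ n by omega),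
        Bool.false_eq_true, if_false] at e1 e2 ⊢
      exact sign_change_zero (code_ne_zero _) (code_ne_zero _) h3 h4 h1 h2 e1 e2
    · simp only [rootD, if_neg i.succ_ne_zero, Nat.add_sub_cancel, if_pos, code_dom hi.le,
        code_dom (show i ≤ n by omega)] at e1 e2 ⊢
      exact sign_change_succ (code_ne_zero _) (code_ne_zero _) h3 h4 h1 h2 e1 e2

end Types

section Embedding

variable {m : ℕ}

/-- The embedding of signed points shifting the index by two. -/
def embD (c : Dom m) : Dom (m + 2) := dom (m + 2) (c.1 + 2) c.2

lemma code_embD (c : Dom m) :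
    code (embD c) = if 0 < code c then code c + 2 else code c - 2 := by
  rw [embD, code_dom (by omega)]
  rcases c with ⟨k, b | b⟩
  · rw [if_neg Bool.false_ne_true, code_false, if_neg (by omega)]
    push_cast
    ring
  · rw [if_pos rfl, code_true, if_pos (by omega)]
    push_cast
    ring

lemma exists_eq_embD {c : Dom (m + 2)} (hc : 2 < (code c).natAbs) : ∃ a, c = embD a := by
  rw [natAbs_code] at hc
  refine ⟨(⟨c.1 - 2, by omega⟩, c.2), ?_⟩
  rw [embD]
  conv_lhs => rw [← dom_self c]
  congr 1
  change (c.1 : ℕ) = c.1 - 2 + 2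
  omega

lemma isFlat (m : ℕ) : IsFlat negD RootD negD (RootB (n := m)) embD (dom (m + 2) 0 true)
    (dom (m + 2) 1 true) := by
  have h0 : code (dom (m + 2) 0 true) = 1 := by rw [code_dom (by omega)]; rfl
  have h1 : code (dom (m + 2) 1 true) = 2 := by rw [code_dom (by omega)]; rfl
  constructor
  · intro a
    rfl
  · intro c
    simp only [← code_injective.eq_iff, code_negD, h0, h1]
    by_cases hc : 2 < (code c).natAbs
    · obtain ⟨a, ha⟩ := exists_eq_embD hc
      exact Or.inl ⟨a, by rw [ha]⟩
    · have := code_ne_zero c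
      omega
  · intro c h
    simp only [RootD, RootB, code_negD] at h
    omega
  · simp only [RootD, RootB, h0, h1]
    omega
  · simp only [RootD, RootB, code_negD, h0, h1]
    omega
  · intro a b hab
    rw [Ne, ← code_injective.eq_iff, code_negD] at hab
    have ha := code_ne_zero a
    have hb := code_ne_zero b
    simp only [RootD, RootB, code_embD]
    split_ifs <;> omega
  · intro a
    have ha := code_ne_zero a
    simp only [RootD, RootB, code_embD, code_negD, h0]
    split_ifs <;> omega
  · intro a c hc
    have ha := code_ne_zero a
    simp only [← code_injective.eq_iff, code_negD, h0, h1] at hc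
    simp only [RootD, RootB, code_embD, h0]
    split_ifs <;> omega

lemma code_gen_succ {n i : ℕ} (hi : i + 1 < n) (a : Dom n) :
    code (gen n (i + 1) a) = if code a = (i : ℤ) + 2 then (i : ℤ) + 1
      else if code a = (i : ℤ) + 1 then (i : ℤ) + 2
      else if code a = -((i : ℤ) + 2) then -((i : ℤ) + 1)
      else if code a = -((i : ℤ) + 1) then -((i : ℤ) + 2) else code a := by
  rw [(isReflection_gen_succ hi).code_apply, code_dom hi.le, code_dom (by omega), if_pos rfl,
    if_pos rfl, show ((i + 1 : ℕ) : ℤ) + 1 = i + 2 by push_cast; ring]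

lemma code_gen_zero {n : ℕ} (hn : 2 ≤ n) (a : Dom n) :
    code (gen n 0 a) = if code a = 2 then -1 else if code a = -1 then 2
      else if code a = -2 then 1 else if code a = 1 then -2 else code a := by
  rw [(isReflection_gen hn (by omega)).code_apply, rootD, if_pos rfl, code_dom (by omega),
    code_dom (by omega), if_pos rfl, if_neg Bool.false_ne_true]
  norm_num

lemma code_genB_zero {n : ℕ} (hn : 0 < n) (a : Dom n) :
    code (genB n 0 a) = if code a = 1 then -1 else if code a = -1 then 1 else code a := by
  rw [(isReflection_genB hn).code_apply, rootB, if_pos rfl, code_dom (by omega),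
    code_dom (by omega), if_pos rfl, if_neg Bool.false_ne_true]
  have := code_ne_zero a
  norm_num
  split_ifs <;> omega

lemma exists_gen_lift {i : ℕ} (hi : i < m) :
    ∃ g ∈ genSubgroup (gen (m + 2)) (Set.Iio (m + 2)),
      (∀ a : Dom m, g (embD a) = embD (genB m i a)) ∧
      (g (dom (m + 2) 0 true) = dom (m + 2) 0 true ∨
        g (dom (m + 2) 0 true) = negD (dom (m + 2) 0 true)) ∧
      g (dom (m + 2) 1 true) = dom (m + 2) 1 true := by
  have h0 : code (dom (m + 2) 0 true) = 1 := by rw [code_dom (by omega)]; rfl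
  have h1 : code (dom (m + 2) 1 true) = 2 := by rw [code_dom (by omega)]; rfl
  have hmem : ∀ j < m + 2, gen (m + 2) j ∈ genSubgroup (gen (m + 2)) (Set.Iio (m + 2)) :=
    fun j hj => gen_mem_genSubgroup hj
  simp only [← code_injective.eq_iff, code_negD, h0, h1]
  rcases i with _ | i
  · have h2 : ∀ a, code (gen (m + 2) 2 a) = if code a = 3 then 2 else if code a = 2 then 3
        else if code a = -3 then -2 else if code a = -2 then -3 else code a :=
      code_gen_succ (i := 1) (by omega)
    have h01 : ∀ a, code ((gen (m + 2) 0 * gen (m + 2) 1) a) = if code a = 1 then -1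
        else if code a = -1 then 1 else if code a = 2 then -2
        else if code a = -2 then 2 else code a := by
      intro a
      have e : code (gen (m + 2) 1 a) = if code a = 2 then 1 else if code a = 1 then 2
        else if code a = -2 then -1 else if code a = -1 then -2 else code a :=
        code_gen_succ (i := 0) (by omega) a
      rw [Equiv.Perm.mul_apply, code_gen_zero (by omega), e]
      generalize code a = u
      split_ifs <;> omega
    refine ⟨gen (m + 2) 2 * (gen (m + 2) 0 * (gen (m + 2) 1 * gen (m + 2) 2)),
      mul_mem (hmem _ (by omega)) (mul_mem (hmem _ (by omega))
        (mul_mem (hmem _ (by omega)) (hmem _ (by omega)))), fun a => ?_, ?_, ?_⟩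
    · have ha := code_ne_zero a
      rw [Equiv.Perm.mul_apply, h2, ← mul_assoc,
        Equiv.Perm.mul_apply, h01, h2, code_embD, code_embD, code_genB_zero hi]
      generalize code a = u at *
      by_cases hu1 : u = 1
      · subst hu1; norm_num
      by_cases hu2 : u = -1
      · subst hu2; norm_num
      rw [if_neg hu1, if_neg hu2]
      generalize hw : (if 0 < u then u + 2 else u - 2) = w
      have hw' : 3 < w.natAbs := by split_ifs at hw <;> omega
      simp only [if_neg (show w ≠ 3 by omega), if_neg (show w ≠ 2 by omega),
        if_neg (show w ≠ -3 by omega), if_neg (show w ≠ -2 by omega),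
        if_neg (show w ≠ 1 by omega), if_neg (show w ≠ -1 by omega)]
    · rw [Equiv.Perm.mul_apply, h2, ← mul_assoc, Equiv.Perm.mul_apply, h01, h2, h0]
      norm_num
    · rw [Equiv.Perm.mul_apply, h2, ← mul_assoc, Equiv.Perm.mul_apply, h01, h2, h1]
      norm_num
  · refine ⟨gen (m + 2) (i + 2 + 1), hmem _ (by omega), fun a => ?_, Or.inl ?_, ?_⟩
    · have ha := code_ne_zero a
      rw [code_gen_succ (by omega), code_embD, code_embD, genB_succ, code_gen_succ hi]
      push_cast
      generalize code a = u at *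
      split_ifs <;> omega
    · rw [code_gen_succ (by omega), h0]
      split_ifs <;> omega
    · rw [code_gen_succ (by omega), h1]
      split_ifs <;> omega

/-- The index set of the face of type `D` restricting to the face of type `B` indexed by `K`. -/
def liftIndex (K : Finset ℕ) : Finset ℕ := insert 0 (insert 1 (K.map (addRightEmbedding 2)))

lemma mem_liftIndex {K : Finset ℕ} {k : ℕ} : k ∈ liftIndex K ↔ k < 2 ∨ k - 2 ∈ K ∧ 2 ≤ k := by
  simp only [liftIndex, Finset.mem_insert, Finset.mem_map, addRightEmbedding_apply]
  constructor
  · rintro (rfl | rfl | ⟨a, ha, rfl⟩)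
    · simp
    · simp
    · simp [ha]
  · rintro (h | ⟨h, h'⟩)
    · omega
    · exact Or.inr (Or.inr ⟨_, h, by omega⟩)

lemma liftIndex_injective : Function.Injective liftIndex := by
  intro K L h
  ext k
  have := Finset.ext_iff.1 h (k + 2)
  simpa [mem_liftIndex] using this

lemma exists_liftIndex_eq {J : Finset ℕ} (hJ : J ⊆ Finset.range (m + 2)) (h0 : 0 ∈ J)
    (h1 : 1 ∈ J) : ∃ K ⊆ Finset.range m, liftIndex K = J := by
  refine ⟨(Finset.range m).filter fun k => k + 2 ∈ J, Finset.filter_subset _ _, ?_⟩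
  ext k
  rw [mem_liftIndex, Finset.mem_filter, Finset.mem_range]
  rcases k with _ | _ | k
  · simpa using h0
  · simpa using h1
  · have := @hJ (k + 2)
    rw [Finset.mem_range] at this
    constructor
    · rintro (h | h)
      · omega
      · exact h.1.2
    · exact fun h => Or.inr ⟨⟨by have := this h; omega, h⟩, by omega⟩

lemma coordD_liftIndex (K : Finset ℕ) (k : ℕ) : coordD (liftIndex K) (k + 2) = coordB K k := by
  induction k with
  | zero => simp [coordD, coordB, mem_liftIndex]
  | succ k ih =>
    rw [coordD, ih, coordB]
    simp [mem_liftIndex]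

lemma oddPt_liftIndex (K : Finset ℕ) (a : Dom m) :
    oddPt (coordD (liftIndex K)) (embD a) = oddPt (coordB K) a := by
  rw [embD, oddPt_dom _ (by omega), coordD_liftIndex]
  rfl

lemma oddPt_liftIndex_zero (K : Finset ℕ) :
    oddPt (coordD (liftIndex K)) (dom (m + 2) 0 true) = 0 ∧
      oddPt (coordD (liftIndex K)) (dom (m + 2) 1 true) = 0 := by
  rw [oddPt_dom _ (by omega), oddPt_dom _ (by omega)]
  simp [coordD, mem_liftIndex]

end Embedding

section Compositions

lemma exists_composition {N : ℕ} (hN : 1 ≤ N) : ∀ T : Set ℕ, (∀ t ∈ T, 0 < t ∧ t < N) →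
    ∃ (x : ℕ) (l : List ℕ), 0 < x ∧ (∀ y ∈ l, 0 < y) ∧ x + l.sum = N ∧
      ∀ k, (∃ j < l.length, k = x + (l.take j).sum) ↔ k ∈ T := by
  induction N, hN using Nat.le_induction with
  | base =>
    intro T hT
    refine ⟨1, [], one_pos, by simp, rfl, fun k => ⟨?_, fun hk => ?_⟩⟩
    · rintro ⟨j, hj, -⟩
      exact absurd hj (Nat.not_lt_zero j)
    · have := hT k hk
      omega
  | succ N hN ih =>
    intro T hT
    obtain ⟨x, l, hx, hl, hsum, h⟩ := ih {t | 0 < t ∧ t + 1 ∈ T} fun t ht =>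
      ⟨ht.1, by have := hT _ ht.2; omega⟩
    simp only [Set.mem_ofPred_eq] at h
    by_cases h1 : 1 ∈ T
    · refine ⟨1, x :: l, one_pos, ?_, ?_, fun k => ⟨?_, fun hk => ?_⟩⟩
      · simpa using ⟨hx, hl⟩
      · rw [List.sum_cons]
        omega
      · rintro ⟨j, hj, rfl⟩
        rcases j with _ | j
        · exact h1
        · have := ((h _).1 ⟨j, by simpa using hj, rfl⟩).2
          rwa [add_comm] at this
      · rcases eq_or_ne k 1 with rfl | hk1
        · exact ⟨0, by simp, rfl⟩
        · have h0 := (hT k hk).1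
          obtain ⟨j, hj, he⟩ := (h (k - 1)).2 ⟨by omega, by rwa [Nat.sub_add_cancel h0]⟩
          refine ⟨j + 1, by simpa using hj, ?_⟩
          rw [List.take_succ_cons, List.sum_cons]
          omega
    · refine ⟨x + 1, l, x.succ_pos, hl, by omega, fun k => ⟨?_, fun hk => ?_⟩⟩
      · rintro ⟨j, hj, rfl⟩
        have := ((h _).1 ⟨j, hj, rfl⟩).2
        rwa [add_right_comm] at this
      · have h0 := (hT k hk).1
        have hk1 : k ≠ 1 := fun e => h1 (e ▸ hk)
        obtain ⟨j, hj, he⟩ := (h (k - 1)).2 ⟨by omega, by rwa [Nat.sub_add_cancel h0]⟩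
        exact ⟨j, hj, by omega⟩

lemma exists_psum_eq_iff {x : ℕ} {l : List ℕ} {k : ℕ} :
    (∃ j, 1 ≤ j ∧ j < (x :: l).length ∧ k = psum (x :: l) j) ↔
      ∃ j < l.length, k = x + (l.take j).sum := by
  constructor
  · rintro ⟨_ | j, h1, h2, rfl⟩
    · omega
    · exact ⟨j, by simpa using h2, by rw [psum, List.take_succ_cons, List.sum_cons]⟩
  · rintro ⟨j, hj, rfl⟩
    exact ⟨j + 1, by omega, by simpa using hj, by rw [psum, List.take_succ_cons, List.sum_cons]⟩

lemma exists_memC_iff {n : ℕ} (hn : 2 ≤ n) {J : Set ℕ} (hJ : J ⊆ Set.Iio n) :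
    (∃ k q, k ≠ Kind.lt ∧ memC n k q ∧ Set.Iio n \ JofC n k q = J) ↔ ¬ (0 ∈ J ∧ 1 ∈ J) := by
  constructor
  · rintro ⟨k, q, hk, -, rfl⟩ ⟨h0, h1⟩
    rcases k with _ | _ | _ | _
    · exact hk rfl
    · exact h0.2 (Or.inl rfl)
    · exact h0.2 (Or.inl rfl)
    · exact h1.2 (Or.inl rfl)
  · intro h
    by_cases h0 : 0 ∈ J
    · have h1 : 1 ∉ J := fun h1 => h ⟨h0, h1⟩
      obtain ⟨x, l, hx, hl, hsum, hT⟩ := exists_composition (by omega)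
        {t | 1 < t ∧ t < n ∧ t ∉ J} fun t ht => ⟨by have := ht.1; omega, ht.2.1⟩
      have hx1 : x ≠ 1 := by
        rintro rfl
        have := ((hT 1).1 ⟨0, List.length_pos_iff.2 ?_, rfl⟩).1
        · omega
        · rintro rfl
          simp at hsum
          omega
      refine ⟨.prime, x :: l, nofun, ⟨by simpa using ⟨hx, hl⟩, hsum, ?_⟩, ?_⟩
      · change 2 ≤ x
        omega
      · ext t
        have hb : t ∈ J → t < n := fun ht => hJ ht
        simp only [JofC, exists_psum_eq_iff, hT, Set.mem_sdiff, Set.mem_Iio, Set.mem_union,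
          Set.mem_singleton_iff, Set.mem_ofPred_eq]
        by_cases ht0 : t = 0
        · subst ht0; simp [h0, hb h0]
        by_cases ht1 : t = 1
        · subst ht1; simp [h1]
        by_cases ht : t ∈ J
        · simp [ht, hb ht, ht1]
        · simp only [ht, not_false_eq_true, and_true, iff_false]
          omega
    · obtain ⟨x, l, hx, hl, hsum, hT⟩ := exists_composition (by omega)
        {t | 0 < t ∧ t < n ∧ t ∉ J} fun t ht => ⟨ht.1, ht.2.1⟩
      have hset : Set.Iio n \ ({0} ∪ {k | ∃ j, 1 ≤ j ∧ j < (x :: l).length ∧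
          k = psum (x :: l) j}) = J := by
        ext t
        have hb : t ∈ J → t < n := fun ht => hJ ht
        simp only [exists_psum_eq_iff, hT, Set.mem_sdiff, Set.mem_Iio, Set.mem_union,
          Set.mem_singleton_iff, Set.mem_ofPred_eq]
        by_cases ht0 : t = 0
        · subst ht0; simp [h0]
        by_cases ht : t ∈ J
        · simp [ht, hb ht, ht0]
        · simp only [ht, not_false_eq_true, and_true, iff_false]
          omega
      have hpos : ∀ y ∈ x :: l, 0 < y := by simpa using ⟨hx, hl⟩
      by_cases hx1 : x = 1
      · exact ⟨.one, x :: l, nofun, ⟨hpos, hsum, hx1⟩, hset⟩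
      · exact ⟨.reg, x :: l, nofun, ⟨hpos, hsum, show 2 ≤ x by omega⟩, hset⟩

lemma mem_idealGensSub_iff {m : ℕ} (x : SigmaDalg (m + 2)) :
    x ∈ idealGensSub (m + 2) ↔ ∃ J ⊆ Finset.range (m + 2),
      (∀ K ⊆ Finset.range m, liftIndex K ≠ J) ∧
        (x : MonoidAlgebra ℚ (Equiv.Perm (Dom (m + 2)))) =
          repSum (gen (m + 2)) (m + 2) (J : Set ℕ) := by
  constructor
  · rintro ⟨k, q, hk, hq, hx⟩
    have hsub : Set.Iio (m + 2) \ JofC (m + 2) k q ⊆ Set.Iio (m + 2) := Set.sdiff_subset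
    have h := (exists_memC_iff (by omega) hsub).1 ⟨k, q, hk, hq, rfl⟩
    have hcoe : (((Finset.range (m + 2)).filter fun i => i ∉ JofC (m + 2) k q : Finset ℕ) :
        Set ℕ) = Set.Iio (m + 2) \ JofC (m + 2) k q := by
      ext i
      simp
    refine ⟨(Finset.range (m + 2)).filter fun i => i ∉ JofC (m + 2) k q,
      Finset.filter_subset _ _, fun K _ hK => h ?_, ?_⟩
    · rw [← hcoe, ← hK]
      exact ⟨mem_liftIndex.2 (Or.inl two_pos), mem_liftIndex.2 (Or.inl one_lt_two)⟩
    · rw [hx, hcoe]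
      rfl
  · rintro ⟨J, hJ, hne, hx⟩
    have hJ' : (J : Set ℕ) ⊆ Set.Iio (m + 2) := fun i hi => Finset.mem_range.1 (hJ hi)
    obtain ⟨k, q, hk, hq, he⟩ := (exists_memC_iff (by omega) hJ').2 fun h => by
      obtain ⟨K, hK, hK'⟩ := exists_liftIndex_eq hJ h.1 h.2
      exact hne K hK hK'
    refine ⟨k, q, hk, hq, ?_⟩
    rw [hx, B, he]
    rfl

end Compositions

set_option synthInstance.maxHeartbeats 1000000 in
/-- For `n ≥ 4`, the descent algebra `ΣB_{n-2}` of the hyperoctahedral group is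
isomorphic, as a `ℚ`-algebra, to the quotient `ΣD_n/𝓘`. -/
theorem sigmaB_iso_quotient (n : ℕ) (hn : 4 ≤ n) :
    ∃ e : ↥(SigmaBalg (n - 2)) ≃+* (IdealI n).ringCon.Quotient,
      ∀ (c : ℚ) (x : ↥(SigmaBalg (n - 2))), e (c • x) = c • e x := by
  obtain ⟨m, rfl⟩ : ∃ m, n = m + 2 := ⟨n - 2, by omega⟩
  have D := signedDataD (n := m + 2) (by omega)
  have D' := signedDataB m
  have E := isFlat m
  exact exists_descentAlg_equiv_quotient D.arrangement D'.arrangement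
    (restrictAlgHom (flatRoots negD (dom (m + 2) 0 true) (dom (m + 2) 1 true))
      (flatIndex negD embD (dom (m + 2) 0 true)))
    (fun a ha => E.map_mem_invAlg D D' (fun i hi => exists_gen_lift hi) ha) liftIndex
    (fun K hK k hk => by
      have := @hK (k - 2)
      rw [Finset.mem_range] at this ⊢
      rcases mem_liftIndex.1 hk with h | h
      · omega
      · have := this h.1
        omega)
    liftIndex_injective
    (fun a ha K _ => E.coeff_map (pt' := fun J => oddPt (coordB J)) D ha (K := K)
      (oddPt_liftIndex_zero K) (oddPt_liftIndex K))
    (idealGensSub (m + 2)) mem_idealGensSub_iff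

end DescentD
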